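/- arXiv:1507.06900 — 2 statements merged into one kernel-verified Lean document; each statement's English description precedes it below -/
import Mathlib

section
/- A continuous function S : Δ⁺ → ℝ is symmetric, subadditive, and additive if and only if there exist a constant c ≥ 0 and constants c_n ∈ ℝ (n ∈ ℕ) satisfying c_{mn} = c_m + c_n for all m, n, such that S(p) = c·H(p) + c_n for all p ∈ Δ_n⁺ and all n ∈ ℕ, where H is the Shannon entropy. -/
open scoped BigOperators

/-- `p` is a probability distribution on the finite type `ι`. -/
def IsProbDist {ι : Type*} [Fintype ι] (p : ι → ℝ) : Prop :=
  (∀ i, 0 ≤ p i) ∧ ∑ i, p i = 1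

/-- `p` is a probability distribution with strictly positive entries. -/
def IsPosProbDist {ι : Type*} [Fintype ι] (p : ι → ℝ) : Prop :=
  (∀ i, 0 < p i) ∧ ∑ i, p i = 1

/-- `p` majorizes `q`: for every `k`, the sum of the `k` largest entries of `p` is at least
the sum of the `k` largest entries of `q`.  For nonnegative vectors this is equivalent to:
for every set `A` of indices of `q` there is a set `B` of indices of `p` with `|B| ≤ |A|`
whose `p`-sum dominates the `q`-sum over `A`. -/
def Majorizes {ι κ : Type*} [Fintype ι] [Fintype κ] (p : ι → ℝ) (q : κ → ℝ) : Prop :=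
  ∀ A : Finset κ, ∃ B : Finset ι, B.card ≤ A.card ∧ ∑ j ∈ A, q j ≤ ∑ i ∈ B, p i

/-- Kronecker (tensor) product of two vectors. -/
def kron {ι κ : Type*} (p : ι → ℝ) (q : κ → ℝ) : ι × κ → ℝ :=
  fun x => p x.1 * q x.2

/-- Shannon entropy (natural logarithm; note `Real.log 0 = 0`, so `0 log 0 = 0`). -/
noncomputable def shannonEntropy {ι : Type*} [Fintype ι] (p : ι → ℝ) : ℝ :=
  -∑ i, p i * Real.log (p i)

open Classical in
/-- The number of nonzero entries of `p`. -/
noncomputable def distRank {ι : Type*} [Fintype ι] (p : ι → ℝ) : ℕ :=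
  (Finset.univ.filter fun i => p i ≠ 0).card

/-- Marginal of a `k`-partite distribution on its `i`-th factor. -/
noncomputable def marginal {k : ℕ} {d : Fin k → ℕ} (r : (∀ i, Fin (d i)) → ℝ) (i : Fin k) :
    Fin (d i) → ℝ :=
  fun b => ∑ y : ∀ j, Fin (d j), if y i = b then r y else 0

open Classical in
/-- Rényi entropy of order `α` (with `H₁` being the Shannon entropy). -/
noncomputable def renyi {ι : Type*} [Fintype ι] (α : ℝ) (p : ι → ℝ) : ℝ :=
  if α = 1 then shannonEntropy p
  else (Real.sign α / (1 - α)) * Real.log (∑ i, p i ^ α)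

/-- Min-entropy `H_∞(p) = -log (max_i p_i)`. -/
noncomputable def renyiInf {ι : Type*} [Fintype ι] (p : ι → ℝ) : ℝ :=
  -Real.log (⨆ i, p i)

/-- Burg entropy `H_Burg(p) = (1/m) ∑ log p_i`. -/
noncomputable def burg {ι : Type*} [Fintype ι] (p : ι → ℝ) : ℝ :=
  (1 / (Fintype.card ι : ℝ)) * ∑ i, Real.log (p i)

open Classical in
/-- Rényi entropy as an extended real: it is `-∞` for `α < 0` when `p` has a zero entry. -/
noncomputable def renyiE {ι : Type*} [Fintype ι] (α : ℝ) (p : ι → ℝ) : EReal :=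
  if α < 0 ∧ ∃ i, p i = 0 then ⊥ else (renyi α p : EReal)

open Classical in
/-- Burg entropy as an extended real: it is `-∞` when `p` has a zero entry. -/
noncomputable def burgE {ι : Type*} [Fintype ι] (p : ι → ℝ) : EReal :=
  if ∃ i, p i = 0 then ⊥ else (burg p : EReal)

/-- `p` trumps `q`: there is a catalyst distribution `r` with `p ⊗ r ≻ q ⊗ r`. -/
def Trumps {ι κ : Type*} [Fintype ι] [Fintype κ] (p : ι → ℝ) (q : κ → ℝ) : Prop :=
  ∃ (n : ℕ) (r : Fin n → ℝ), IsProbDist r ∧ Majorizes (kron p r) (kron q r)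

/-- The bipartite extension `q_{AB}` of `q` with parameters `a i ∈ [0, q i]` and `n`:
the `m × (n+1)` matrix whose first column is `(q i - a i)` and whose remaining `n`
columns all equal `(a i / n)`. -/
noncomputable def qAB {m : ℕ} (q a : Fin m → ℝ) (n : ℕ) : Fin m × Fin (n + 1) → ℝ :=
  fun x => if x.2 = 0 then q x.1 - a x.1 else a x.1 / n

/-- The `B`-marginal `(1 - a, a/n, …, a/n)` of `qAB`, where `a = ∑ i, a i`. -/
noncomputable def qBext {m : ℕ} (a : Fin m → ℝ) (n : ℕ) : Fin (n + 1) → ℝ :=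
  fun j => if j = 0 then 1 - ∑ i, a i else (∑ i, a i) / n

/-- Symmetry of an entropy-like functional on positive distributions. -/
def SymmetricS (S : ∀ n : ℕ, (Fin n → ℝ) → ℝ) : Prop :=
  ∀ (n : ℕ) (p : Fin n → ℝ), IsPosProbDist p →
    ∀ σ : Equiv.Perm (Fin n), S n (p ∘ σ) = S n p

/-- Additivity: `S(p ⊗ q) = S(p) + S(q)`. -/
def AdditiveS (S : ∀ n : ℕ, (Fin n → ℝ) → ℝ) : Prop :=
  ∀ (m n : ℕ) (p : Fin m → ℝ) (q : Fin n → ℝ), IsPosProbDist p → IsPosProbDist q →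
    S (m * n) (fun x => kron p q (finProdFinEquiv.symm x)) = S m p + S n q

/-- Subadditivity: `S(p_{AB}) ≤ S(p_A ⊗ p_B)` for bipartite distributions. -/
def SubadditiveS (S : ∀ n : ℕ, (Fin n → ℝ) → ℝ) : Prop :=
  ∀ (m n : ℕ) (P : Fin m × Fin n → ℝ), IsPosProbDist P →
    S (m * n) (fun x => P (finProdFinEquiv.symm x)) ≤
      S (m * n) (fun x =>
        kron (fun i => ∑ j, P (i, j)) (fun j => ∑ i, P (i, j)) (finProdFinEquiv.symm x))

/-- Continuity of `S` on each simplex of positive distributions. -/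
def ContinuousS (S : ∀ n : ℕ, (Fin n → ℝ) → ℝ) : Prop :=
  ∀ n : ℕ, ContinuousOn (S n) {p : Fin n → ℝ | IsPosProbDist p}

open Set Filter Topology in
theorem aux_concave (f : ℝ → ℝ) (hf : ContinuousOn f (Set.Ioo 0 1))
    (hmid : ∀ q ∈ Set.Ioo (0:ℝ) 1, ∀ r ∈ Set.Ioo (0:ℝ) 1, f q + f r ≤ 2 * f ((q + r) / 2)) :
    ConcaveOn ℝ (Set.Ioo 0 1) f := by
  refine LinearOrder.concaveOn_of_lt (convex_Ioo 0 1) ?_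
  intro x hx y hy hxy a b ha hb hab
  set K : ℝ := (f y - f x) / (y - x) with hK
  have hyx : 0 < y - x := sub_pos.2 hxy
  have hKm : K * (y - x) = f y - f x := by rw [hK]; field_simp
  set h : ℝ → ℝ := fun t => f t - (f x + (t - x) * K) with hh
  have hsub : Icc x y ⊆ Ioo (0:ℝ) 1 := fun t ht => ⟨lt_of_lt_of_le hx.1 ht.1, lt_of_le_of_lt ht.2 hy.2⟩
  have hc : ContinuousOn h (Icc x y) := by
    refine (hf.mono hsub).sub ?_
    fun_prop
  have hhx : h x = 0 := by simp [hh]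
  have hhy : h y = 0 := by simp only [hh]; linarith
  have hhm : ∀ u ∈ Icc x y, ∀ v ∈ Icc x y, h u + h v ≤ 2 * h ((u + v) / 2) := by
    intro u hu v hv
    have := hmid u (hsub hu) v (hsub hv)
    simp only [hh]; linarith
  have key : ∀ t ∈ Icc x y, 0 ≤ h t := by
    obtain ⟨t₁, ht₁, hmin⟩ := isCompact_Icc.exists_isMinOn (nonempty_Icc.2 hxy.le) hc
    have hmin' : ∀ t ∈ Icc x y, h t₁ ≤ h t := fun t ht => hmin ht
    by_contra hcon
    push Not at hcon
    obtain ⟨t₂, ht₂, hneg⟩ := hcon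
    have hm : h t₁ < 0 := lt_of_le_of_lt (hmin' t₂ ht₂) hneg
    have hcl : IsClosed (Icc x y ∩ h ⁻¹' {h t₁}) :=
      hc.preimage_isClosed_of_isClosed isClosed_Icc isClosed_singleton
    have hcomp : IsCompact (Icc x y ∩ h ⁻¹' {h t₁}) :=
      isCompact_Icc.of_isClosed_subset hcl inter_subset_left
    obtain ⟨t₀, ht₀, hleast⟩ := hcomp.exists_isLeast ⟨t₁, ht₁, rfl⟩
    have h0 : h t₀ = h t₁ := ht₀.2
    have hlt1 : x < t₀ := lt_of_le_of_ne ht₀.1.1 (by rintro rfl; linarith)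
    have hlt2 : t₀ < y := lt_of_le_of_ne ht₀.1.2 (by rintro rfl; linarith)
    set δ := min (t₀ - x) (y - t₀) with hδ
    have hδ0 : 0 < δ := lt_min (by linarith) (by linarith)
    have hδ1 : δ ≤ t₀ - x := min_le_left _ _
    have hδ2 : δ ≤ y - t₀ := min_le_right _ _
    have m1 : t₀ - δ ∈ Icc x y := ⟨by linarith, by linarith⟩
    have m2 : t₀ + δ ∈ Icc x y := ⟨by linarith, by linarith⟩
    have e := hhm _ m1 _ m2
    rw [show (t₀ - δ + (t₀ + δ)) / 2 = t₀ by ring] at e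
    have e1 := hmin' _ m1
    have e2 := hmin' _ m2
    have : t₀ ≤ t₀ - δ := hleast ⟨m1, by show h (t₀ - δ) = h t₁; linarith⟩
    linarith
  have hb' : b = 1 - a := by linarith
  have := key (a * x + b * y) ⟨by subst hb'; nlinarith, by subst hb'; nlinarith⟩
  simp only [hh] at this
  simp only [smul_eq_mul]
  have e : (a * x + b * y - x) * K = b * (f y - f x) := by
    rw [← hKm, hb']; ring
  rw [e] at this
  subst hb'
  linarith

open Set Filter Topology in
theorem aux_squeeze (f G : ℝ → ℝ) (p d r b : ℝ) (hp0 : 0 ≤ p) (hp1 : p ≤ 1) (hrb : r < b)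
    (hf : HasDerivWithinAt f d (Set.Ici r) r)
    (hlo : ∀ q ∈ Set.Ioo r b, f q - f (q + p * (r - q)) ≤ G q - G r)
    (hhi : ∀ q ∈ Set.Ioo r b, G q - G r ≤ f (r + p * (q - r)) - f r) :
    HasDerivWithinAt G (p * d) (Set.Ici r) r := by
  have comp : ∀ s : ℝ, 0 ≤ s → HasDerivWithinAt (fun q => f (r + s * (q - r))) (s * d) (Ioi r) r := by
    intro s hs
    have h1 : HasDerivWithinAt (fun q : ℝ => r + s * (q - r)) s (Ioi r) r := by
      have := (((hasDerivAt_id r).sub_const r).const_mul s).const_add r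
      simpa using this.hasDerivWithinAt
    have h2 : HasDerivWithinAt f d (Ici r) (r + s * (r - r)) := by simpa using hf
    have := h2.comp r h1 (fun q hq => by
      have : r < q := hq
      show r ≤ r + s * (q - r)
      nlinarith)
    rw [mul_comm]; exact this
  have hU := comp p hp0
  have hV := (hf.Ioi_of_Ici).sub (comp (1 - p) (by linarith))
  rw [← hasDerivWithinAt_Ioi_iff_Ici]
  rw [hasDerivWithinAt_iff_tendsto_slope' self_notMem_Ioi] at *
  have hV' : Tendsto (slope (f - fun q => f (r + (1 - p) * (q - r))) r) (𝓝[>] r) (𝓝 (p * d)) := by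
    convert hV using 2; ring
  refine tendsto_of_tendsto_of_tendsto_of_le_of_le' hV' hU ?_ ?_
  · filter_upwards [Ioo_mem_nhdsGT hrb] with q hq
    rw [slope_def_field, slope_def_field]
    have := hlo q hq
    have e : r + (1 - p) * (q - r) = q + p * (r - q) := by ring
    refine div_le_div_of_nonneg_right ?_ (by linarith [hq.1])
    simp only [Pi.sub_apply, e, sub_self, mul_zero, add_zero]
    linarith
  · filter_upwards [Ioo_mem_nhdsGT hrb] with q hq
    rw [slope_def_field, slope_def_field]
    have := hhi q hq
    refine div_le_div_of_nonneg_right ?_ (by linarith [hq.1])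
    simp only [sub_self, mul_zero, add_zero]
    linarith

open Set in
theorem aux_const (G : ℝ → ℝ) (hc : ContinuousOn G (Set.Ioo 0 1))
    (hd : ∀ x ∈ Set.Ioo (0:ℝ) 1, HasDerivWithinAt G 0 (Set.Ici x) x)
    (a b : ℝ) (ha : a ∈ Set.Ioo (0:ℝ) 1) (hb : b ∈ Set.Ioo (0:ℝ) 1) : G a = G b := by
  wlog hab : a ≤ b generalizing a b
  · exact (this b a hb ha (by linarith)).symm
  have hsub : Icc a b ⊆ Ioo (0:ℝ) 1 :=
    fun t ht => ⟨lt_of_lt_of_le ha.1 ht.1, lt_of_le_of_lt ht.2 hb.2⟩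
  exact (constant_of_has_deriv_right_zero (hc.mono hsub)
    (fun x hx => hd x (hsub ⟨hx.1, hx.2.le⟩)) b ⟨hab, le_rfl⟩).symm

/-- concave functions: right derivative exists and is antitone -/
theorem aux_rightDeriv (f : ℝ → ℝ) (hf : ConcaveOn ℝ (Set.Ioo 0 1) f) :
    ∃ φ : ℝ → ℝ, AntitoneOn φ (Set.Ioo 0 1) ∧
      ∀ x ∈ Set.Ioo (0:ℝ) 1, HasDerivWithinAt f (φ x) (Set.Ici x) x := by
  have hc : ConvexOn ℝ (Set.Ioo 0 1) (-f) := hf.neg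
  refine ⟨fun x => - derivWithin (-f) (Set.Ioi x) x, ?_, ?_⟩
  · have := hc.monotoneOn_rightDeriv
    rw [interior_Ioo] at this
    exact this.neg
  · intro x hx
    have := hc.hasDerivWithinAt_rightDeriv_of_mem_interior (x := x) (by rwa [interior_Ioo])
    rw [← hasDerivWithinAt_Ioi_iff_Ici]
    simpa using this.neg

/-- antitone additive functions are linear -/
theorem aux_additive (ψ : ℝ → ℝ) (hanti : Antitone ψ)
    (hadd : ∀ a b, ψ a - ψ b = ψ (a - b) - ψ 0) :
    ∃ c : ℝ, 0 ≤ c ∧ ∀ v, ψ v = ψ 0 - c * v := by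
  let A : ℝ →+ ℝ := AddMonoidHom.mk' (fun v => ψ v - ψ 0) (by
    intro a b
    have := hadd (a + b) b
    rw [add_sub_cancel_right] at this
    linarith)
  have hm : Measurable A := hanti.measurable.sub_const _
  have hcont : Continuous A := MeasureTheory.Measure.AddMonoidHom.continuous_of_measurable A hm
  have hlin : ∀ v, A v = v * A 1 := by
    intro v
    have := (A.toRealLinearMap hcont).map_smul v 1
    simpa using this
  have e1 : A 1 = ψ 1 - ψ 0 := rfl
  refine ⟨-A 1, ?_, ?_⟩
  · have := hanti (zero_le_one (α := ℝ)); linarith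
  · intro v
    have h2 : A v = ψ v - ψ 0 := rfl
    have := hlin v
    linarith
/-- homogeneous extension -/
noncomputable def auxF (f : ℝ → ℝ) (a b : ℝ) : ℝ := (a + b) * f (b / (a + b))

open Set in
theorem aux_FE_deriv (f φ : ℝ → ℝ)
    (hφ : ∀ x ∈ Set.Ioo (0:ℝ) 1, HasDerivWithinAt f (φ x) (Set.Ici x) x)
    (hsymm : ∀ t ∈ Set.Ioo (0:ℝ) 1, f (1 - t) = f t)
    (x y z : ℝ) (hx : 0 < x) (hy : 0 < y) (hz : 0 < z)
    (hid : ∀ ε : ℝ, 0 ≤ ε → ε < y → ε < z →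
      auxF f (y - ε) (x + ε) - auxF f y x - auxF f (z - ε) (x + ε) + auxF f z x
        = auxF f (y - ε) z - auxF f (z - ε) y) :
    φ (x / (y + x)) - φ (x / (z + x)) =
      z / (y + z) * φ (z / (y + z)) - y / (z + y) * φ (y / (z + y)) := by
  set δ := min y z / 2 with hδ
  have hm : 0 < min y z := lt_min hy hz
  have hδ0 : 0 < δ := by positivity
  have hδy : δ < y := by have := min_le_left y z; linarith
  have hδz : δ < z := by have := min_le_right y z; linarith
  have d1 : ∀ w : ℝ, 0 < w → HasDerivWithinAt (fun ε => auxF f (w - ε) (x + ε)) (φ (x / (w + x))) (Icc 0 δ) 0 := by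
    intro w hw
    have hs : 0 < w + x := by positivity
    have h1 : HasDerivWithinAt (fun ε : ℝ => (x + ε) / (w + x)) (1 / (w + x)) (Icc 0 δ) 0 :=
      (((hasDerivAt_id (0:ℝ)).const_add x).div_const (w + x)).hasDerivWithinAt
    have h2 : HasDerivWithinAt f (φ (x / (w + x))) (Ici (x / (w + x))) ((x + 0) / (w + x)) := by
      rw [add_zero]
      exact hφ _ ⟨by positivity, by rw [div_lt_one hs]; linarith⟩
    have h3 := (h2.comp 0 h1 (fun ε hε => by
      show x / (w + x) ≤ (x + ε) / (w + x)
      have := hε.1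
      gcongr; linarith)).const_mul (w + x)
    have e : (w + x) * (φ (x / (w + x)) * (1 / (w + x))) = φ (x / (w + x)) := by field_simp
    rw [e] at h3
    refine h3.congr_of_mem ?_ ⟨le_rfl, hδ0.le⟩
    intro ε hε
    simp only [auxF, Function.comp]
    rw [show w - ε + (x + ε) = w + x by ring]
  have d2 : ∀ u w : ℝ, δ < u → 0 < w → HasDerivWithinAt (fun ε => auxF f (u - ε) w)
      (- f (w / (u + w)) + w / (u + w) * φ (w / (u + w))) (Icc 0 δ) 0 := by
    intro u w hu hw
    have hu0 : 0 < u := by linarith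
    have hs : 0 < u + w := by positivity
    have h0 : HasDerivAt (fun ε : ℝ => u - ε + w) (-1) 0 :=
      ((hasDerivAt_id (0:ℝ)).const_sub u).add_const w
    have h1 : HasDerivWithinAt (fun ε : ℝ => w / (u - ε + w)) (w / (u + w) ^ 2) (Icc 0 δ) 0 := by
      have := ((hasDerivAt_const (0:ℝ) w).div h0 (by simp; positivity)).hasDerivWithinAt (s := Icc 0 δ)
      have e : (0 * (u - 0 + w) - w * (-1)) / (u - 0 + w) ^ 2 = w / (u + w) ^ 2 := by simp
      rw [e] at this
      exact this
    have h2 : HasDerivWithinAt f (φ (w / (u + w))) (Ici (w / (u + w))) (w / (u - 0 + w)) := by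
      rw [sub_zero]
      exact hφ _ ⟨by positivity, by rw [div_lt_one hs]; linarith⟩
    have h3 := h0.hasDerivWithinAt.mul (h2.comp 0 h1 (fun ε hε => by
      show w / (u + w) ≤ w / (u - ε + w)
      have := hε.1
      have := hε.2
      apply div_le_div_of_nonneg_left hw.le <;> linarith))
    have e : -1 * (f ∘ fun ε : ℝ => w / (u - ε + w)) 0
        + (u - 0 + w) * (φ (w / (u + w)) * (w / (u + w) ^ 2)) =
        - f (w / (u + w)) + w / (u + w) * φ (w / (u + w)) := by
      simp only [Function.comp, sub_zero]
      field_simp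
    rw [e] at h3
    exact h3
  have L := (((d1 y hy).sub_const (auxF f y x)).sub (d1 z hz)).add_const (auxF f z x)
  have R := (d2 y z hδy hz).sub (d2 z y hδz hy)
  have L' : HasDerivWithinAt (fun ε => auxF f (y - ε) z - auxF f (z - ε) y)
      (φ (x / (y + x)) - φ (x / (z + x))) (Icc 0 δ) 0 := by
    refine L.congr_of_mem ?_ ⟨le_rfl, hδ0.le⟩
    intro ε hε
    exact (hid ε hε.1 (by linarith [hε.2]) (by linarith [hε.2])).symm
  have huniq : UniqueDiffWithinAt ℝ (Icc 0 δ) 0 := uniqueDiffOn_Icc hδ0 0 ⟨le_rfl, hδ0.le⟩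
  have E := huniq.eq_deriv _ L' R
  have hs : f (z / (y + z)) = f (y / (z + y)) := by
    rw [← hsymm (y / (z + y)) ⟨by positivity, by rw [div_lt_one (by positivity)]; linarith⟩]
    congr 1
    field_simp; ring
  rw [hs] at E
  linarith

open Set in
theorem aux_FE (f : ℝ → ℝ) (hcont : ContinuousOn f (Set.Ioo 0 1))
    (hconc : ConcaveOn ℝ (Set.Ioo 0 1) f)
    (hsymm : ∀ t ∈ Set.Ioo (0:ℝ) 1, f (1 - t) = f t)
    (hid : ∀ x y z : ℝ, 0 < x → 0 < y → 0 < z → x + y + z = 1 →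
      ∀ ε : ℝ, 0 ≤ ε → ε < y → ε < z →
      auxF f (y - ε) (x + ε) - auxF f y x - auxF f (z - ε) (x + ε) + auxF f z x
        = auxF f (y - ε) z - auxF f (z - ε) y) :
    ∃ c : ℝ, 0 ≤ c ∧ ∃ k : ℝ, ∀ t ∈ Set.Ioo (0:ℝ) 1, f t = c * Real.binEntropy t + k := by
  obtain ⟨φ, hanti, hφ⟩ := aux_rightDeriv f hconc
  set ψ : ℝ → ℝ := fun v => φ (Real.sigmoid v) with hψ
  have hmem : ∀ v, Real.sigmoid v ∈ Ioo (0:ℝ) 1 := fun v => ⟨Real.sigmoid_pos v, Real.sigmoid_lt_one v⟩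
  have hψanti : Antitone ψ := fun a b hab =>
    hanti (hmem a) (hmem b) (Real.sigmoid_le hab)
  have main : ∀ a b : ℝ, ψ a - ψ b =
      Real.sigmoid (a - b) * ψ (a - b) - Real.sigmoid (b - a) * ψ (b - a) := by
    intro a b
    set N := 1 + Real.exp (-a) + Real.exp (-b) with hN
    have hN0 : 0 < N := by positivity
    have := aux_FE_deriv f φ hφ hsymm (1 / N) (Real.exp (-a) / N) (Real.exp (-b) / N)
      (by positivity) (by positivity) (by positivity)
      (hid _ _ _ (by positivity) (by positivity) (by positivity) (by
        rw [hN]; field_simp))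
    have s1 : ∀ a : ℝ, 1 / N / (Real.exp (-a) / N + 1 / N) = Real.sigmoid a := by
      intro a
      rw [Real.sigmoid_def]
      field_simp
      ring
    have s2 : ∀ a b : ℝ, Real.exp (-b) / N / (Real.exp (-a) / N + Real.exp (-b) / N)
        = Real.sigmoid (a - b) := by
      intro a b
      rw [Real.sigmoid_def, show -(a - b) = -a - (-b) by ring, Real.exp_sub]
      field_simp
      ring
    rw [s1, s1, s2, s2] at this
    exact this
  have hadd : ∀ a b, ψ a - ψ b = ψ (a - b) - ψ 0 := by
    intro a b
    have h1 := main a b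
    have h2 := main (a - b) 0
    rw [sub_zero, zero_sub, neg_sub] at h2
    linarith
  obtain ⟨c, hc, hlin⟩ := aux_additive ψ hψanti hadd
  have hφ' : ∀ t ∈ Ioo (0:ℝ) 1, φ t = ψ 0 + c * (Real.log (1 - t) - Real.log t) := by
    intro t ht
    have h1t : 0 < 1 - t := by linarith [ht.2]
    have ht0 : 0 < t := ht.1
    have : Real.sigmoid (Real.log t - Real.log (1 - t)) = t := by
      rw [Real.sigmoid_def, neg_sub, Real.exp_sub, Real.exp_log h1t, Real.exp_log ht0]
      field_simp
      ring
    have h2 := hlin (Real.log t - Real.log (1 - t))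
    simp only [hψ, this] at h2
    rw [h2]; simp only [hψ]; ring
  have hconst := aux_const (fun t => f t - (c * Real.binEntropy t + ψ 0 * t))
    (by
      refine hcont.sub ?_
      have := Real.binEntropy_continuous
      fun_prop)
    (by
      intro t ht
      have h1 := (Real.hasDerivAt_binEntropy ht.1.ne' ht.2.ne).const_mul c
      have h2 := (hasDerivAt_id t).const_mul (ψ 0)
      have h3 := (hφ t ht).sub (h1.add h2).hasDerivWithinAt
      have e : φ t - (c * (Real.log (1 - t) - Real.log t) + ψ 0 * 1) = 0 := by
        rw [hφ' t ht]; ring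
      rw [e] at h3
      exact h3)
  have m4 : (1/4 : ℝ) ∈ Ioo (0:ℝ) 1 := by norm_num
  have m34 : (3/4 : ℝ) ∈ Ioo (0:ℝ) 1 := by norm_num
  have hz : ψ 0 = 0 := by
    have h1 := hconst (1/4) (3/4) m4 m34
    have h2 := hsymm (1/4) m4
    have h3 := Real.binEntropy_one_sub (1/4)
    norm_num at h1 h2 h3
    rw [h2, h3] at h1
    linarith
  refine ⟨c, hc, f (1/4) - c * Real.binEntropy (1/4), fun t ht => ?_⟩
  have h1 := hconst t (1/4) ht m4
  simp only [hz] at h1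
  linarith
/-- redistribute the mass of the coordinates `i, j` -/
noncomputable def auxMv {n : ℕ} (P : Fin n → ℝ) (i j : Fin n) (t : ℝ) : Fin n → ℝ :=
  fun k => if k = i then (P i + P j) * (1 - t) else if k = j then (P i + P j) * t else P k

theorem auxMv_i {n : ℕ} (P : Fin n → ℝ) (i j : Fin n) (t : ℝ) :
    auxMv P i j t i = (P i + P j) * (1 - t) := by simp [auxMv]

theorem auxMv_j {n : ℕ} (P : Fin n → ℝ) (i j : Fin n) (hij : i ≠ j) (t : ℝ) :
    auxMv P i j t j = (P i + P j) * t := by simp [auxMv, hij.symm]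

theorem auxMv_k {n : ℕ} (P : Fin n → ℝ) (i j k : Fin n) (hi : k ≠ i) (hj : k ≠ j) (t : ℝ) :
    auxMv P i j t k = P k := by simp [auxMv, hi, hj]

theorem aux_sum_split {n : ℕ} (i j : Fin n) (hij : i ≠ j) (g : Fin n → ℝ) :
    ∑ k, g k = g i + g j + ∑ k ∈ (Finset.univ.erase i).erase j, g k := by
  rw [← Finset.add_sum_erase _ g (Finset.mem_univ i),
    ← Finset.add_sum_erase (Finset.univ.erase i) g (a := j) (by simp [hij.symm])]
  ring

theorem aux_sum_rest {n : ℕ} (i j : Fin n) (g h : Fin n → ℝ)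
    (e : ∀ k, k ≠ i → k ≠ j → g k = h k) :
    ∑ k ∈ (Finset.univ.erase i).erase j, g k = ∑ k ∈ (Finset.univ.erase i).erase j, h k := by
  refine Finset.sum_congr rfl fun k hk => ?_
  simp only [Finset.mem_erase, Finset.mem_univ, and_true] at hk
  exact e k hk.2 hk.1

theorem auxMv_sum {n : ℕ} (P : Fin n → ℝ) (i j : Fin n) (hij : i ≠ j) (t : ℝ) :
    ∑ k, auxMv P i j t k = ∑ k, P k := by
  rw [aux_sum_split i j hij, aux_sum_split i j hij P, auxMv_i, auxMv_j P i j hij,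
    aux_sum_rest i j _ P (fun k hi hj => auxMv_k P i j k hi hj t)]
  ring

theorem auxMv_pos {n : ℕ} (P : Fin n → ℝ) (hP : IsPosProbDist P) (i j : Fin n) (hij : i ≠ j)
    (t : ℝ) (ht : t ∈ Set.Ioo (0:ℝ) 1) : IsPosProbDist (auxMv P i j t) := by
  refine ⟨fun k => ?_, by rw [auxMv_sum P i j hij, hP.2]⟩
  have h1 := hP.1 i
  have h2 := hP.1 j
  have h3 := hP.1 k
  have h4 := ht.1
  have h5 : 0 < 1 - t := by linarith [ht.2]
  unfold auxMv
  split_ifs <;> positivity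

theorem aux_two (t : ℝ) (ht : t ∈ Set.Ioo (0:ℝ) 1) : IsPosProbDist (![1 - t, t] : Fin 2 → ℝ) := by
  have h4 := ht.1
  have h5 : 0 < 1 - t := by linarith [ht.2]
  refine ⟨fun k => ?_, by simp [Fin.sum_univ_two]⟩
  fin_cases k <;> simp <;> linarith

theorem aux_kron_pos {ι κ : Type*} [Fintype ι] [Fintype κ] (p : ι → ℝ) (q : κ → ℝ)
    (hp : IsPosProbDist p) (hq : IsPosProbDist q) : IsPosProbDist (kron p q) := by
  refine ⟨fun x => mul_pos (hp.1 _) (hq.1 _), ?_⟩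
  simp only [kron]
  rw [Fintype.sum_prod_type]
  simp only [← Finset.mul_sum, hq.2, mul_one, hp.2]

theorem aux_comp_pos {ι κ : Type*} [Fintype ι] [Fintype κ] (p : ι → ℝ)
    (hp : IsPosProbDist p) (e : κ ≃ ι) : IsPosProbDist (fun x => p (e x)) :=
  ⟨fun x => hp.1 _, by rw [Equiv.sum_comp e p, hp.2]⟩

theorem aux_key (S : ∀ n : ℕ, (Fin n → ℝ) → ℝ)
    (hsym : SymmetricS S) (hsub : SubadditiveS S) (hadd : AdditiveS S)
    {n : ℕ} (P : Fin n → ℝ) (hP : IsPosProbDist P) (i j : Fin n) (hij : i ≠ j)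
    (q r : ℝ) (hq : q ∈ Set.Ioo (0:ℝ) 1) (hr : r ∈ Set.Ioo (0:ℝ) 1) 
    (ht : r + (P i + P j) * (q - r) ∈ Set.Ioo (0:ℝ) 1) :
    S n (auxMv P i j q) + S 2 ![1 - r, r] ≤ S n (auxMv P i j r) +
      S 2 ![1 - (r + (P i + P j) * (q - r)), r + (P i + P j) * (q - r)] := by
  set K : Fin n × Fin 2 → ℝ := kron (auxMv P i j q) ![1 - r, r] with hK
  set σ : Equiv.Perm (Fin n × Fin 2) := Equiv.swap (i, 1) (j, 0) with hσ
  have hKpos : IsPosProbDist K := aux_kron_pos _ _ (auxMv_pos P hP i j hij q hq) (aux_two r hr)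
  have hMpos : IsPosProbDist (fun x => K (σ x)) := aux_comp_pos K hKpos σ
  have h1 := hsub n 2 (fun x => K (σ x)) hMpos
  have h2 := hsym (n * 2) (fun x => K (finProdFinEquiv.symm x))
    (aux_comp_pos K hKpos finProdFinEquiv.symm) (finProdFinEquiv.permCongr σ)
  have e2 : ((fun x => K (finProdFinEquiv.symm x)) ∘ (finProdFinEquiv.permCongr σ))
      = fun x => K (σ (finProdFinEquiv.symm x)) := by
    funext x
    show K (finProdFinEquiv.symm (finProdFinEquiv (σ (finProdFinEquiv.symm x)))) = _
    rw [Equiv.symm_apply_apply]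
  rw [e2] at h2
  have h3 := hadd n 2 _ _ (auxMv_pos P hP i j hij q hq) (aux_two r hr)
  have h4 := hadd n 2 _ _ (auxMv_pos P hP i j hij r hr) (aux_two _ ht)
  -- values of the permuted matrix
  have vi0 : K (σ (i, 0)) = (P i + P j) * (1 - q) * (1 - r) := by
    rw [hσ, Equiv.swap_apply_of_ne_of_ne (by simp) (by simp [hij])]
    simp [hK, kron, auxMv_i]
  have vi1 : K (σ (i, 1)) = (P i + P j) * q * (1 - r) := by
    rw [hσ, Equiv.swap_apply_left]
    simp [hK, kron, auxMv_j P i j hij]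
  have vj0 : K (σ (j, 0)) = (P i + P j) * (1 - q) * r := by
    rw [hσ, Equiv.swap_apply_right]
    simp [hK, kron, auxMv_i]
  have vj1 : K (σ (j, 1)) = (P i + P j) * q * r := by
    rw [hσ, Equiv.swap_apply_of_ne_of_ne (by simp [hij.symm]) (by simp)]
    simp [hK, kron, auxMv_j P i j hij]
  have vk : ∀ k, k ≠ i → k ≠ j → ∀ b, K (σ (k, b)) = P k * (![1 - r, r] : Fin 2 → ℝ) b := by
    intro k hi hj b
    rw [hσ, Equiv.swap_apply_of_ne_of_ne (by simp [hi]) (by simp [hj])]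
    simp [hK, kron, auxMv_k P i j k hi hj]
  have row : (fun k => ∑ b, K (σ (k, b))) = auxMv P i j r := by
    funext k
    rw [Fin.sum_univ_two]
    by_cases hi : k = i
    · subst hi; rw [vi0, vi1, auxMv_i]; ring
    by_cases hj : k = j
    · subst hj; rw [vj0, vj1, auxMv_j P i k hij]; ring
    rw [vk k hi hj, vk k hi hj, auxMv_k P i j k hi hj]
    simp; ring
  have hPs := hP.2
  rw [aux_sum_split i j hij] at hPs
  have col : (fun b => ∑ k, K (σ (k, b))) =
      ![1 - (r + (P i + P j) * (q - r)), r + (P i + P j) * (q - r)] := by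
    funext b
    rw [aux_sum_split i j hij, aux_sum_rest i j _ _ (fun k hi hj => vk k hi hj b),
      ← Finset.sum_mul, show ∑ k ∈ (Finset.univ.erase i).erase j, P k = 1 - (P i + P j) by linarith]
    fin_cases b
    · simp only [Fin.zero_eta, vi0, vj0, Matrix.cons_val_zero]; ring
    · simp only [Fin.mk_one, vi1, vj1, Matrix.cons_val_one]
      simp; ring
  rw [row, col] at h1
  rw [h4] at h1
  rw [← hK] at h3
  linarith

theorem aux_f_cont (S : ∀ n : ℕ, (Fin n → ℝ) → ℝ) (hcont : ContinuousS S) :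
    ContinuousOn (fun t => S 2 ![1 - t, t]) (Set.Ioo 0 1) := by
  refine (hcont 2).comp (f := fun t : ℝ => (![1 - t, t] : Fin 2 → ℝ)) ?_ (fun t ht => aux_two t ht)
  refine Continuous.continuousOn ?_
  refine continuous_pi fun k => ?_
  fin_cases k <;> simp <;> fun_prop

theorem aux_mv_cont (S : ∀ n : ℕ, (Fin n → ℝ) → ℝ) (hcont : ContinuousS S)
    {n : ℕ} (P : Fin n → ℝ) (hP : IsPosProbDist P) (i j : Fin n) (hij : i ≠ j) :
    ContinuousOn (fun t => S n (auxMv P i j t)) (Set.Ioo 0 1) := by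
  refine (hcont n).comp (f := fun t : ℝ => auxMv P i j t) ?_ (fun t ht => auxMv_pos P hP i j hij t ht)
  refine Continuous.continuousOn ?_
  refine continuous_pi fun k => ?_
  unfold auxMv
  split_ifs <;> fun_prop

theorem aux_f_symm (S : ∀ n : ℕ, (Fin n → ℝ) → ℝ) (hsym : SymmetricS S)
    (t : ℝ) (ht : t ∈ Set.Ioo (0:ℝ) 1) : S 2 ![1 - (1 - t), 1 - t] = S 2 ![1 - t, t] := by
  rw [← hsym 2 _ (aux_two t ht) (Equiv.swap 0 1)]
  congr 1
  funext k
  fin_cases k <;> simp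

theorem aux_mix_mem (q r p : ℝ) (hq : q ∈ Set.Ioo (0:ℝ) 1) (hr : r ∈ Set.Ioo (0:ℝ) 1)
    (hp0 : 0 ≤ p) (hp1 : p ≤ 1) : r + p * (q - r) ∈ Set.Ioo (0:ℝ) 1 := by
  have := (convex_Ioo (0:ℝ) 1) hr hq (a := 1 - p) (b := p) (by linarith) hp0 (by ring)
  simp only [smul_eq_mul] at this
  convert this using 1; ring

theorem aux_f_conc (S : ∀ n : ℕ, (Fin n → ℝ) → ℝ) (hcont : ContinuousS S)
    (hsym : SymmetricS S) (hsub : SubadditiveS S) (hadd : AdditiveS S) :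
    ConcaveOn ℝ (Set.Ioo 0 1) (fun t => S 2 ![1 - t, t]) := by
  refine aux_concave _ (aux_f_cont S hcont) fun q hq r hr => ?_
  have hP : IsPosProbDist (![1/4, 1/4, 1/2] : Fin 3 → ℝ) := by
    refine ⟨fun k => ?_, by simp [Fin.sum_univ_three]; norm_num⟩
    fin_cases k <;> simp
  have e : (![1/4, 1/4, 1/2] : Fin 3 → ℝ) 0 + (![1/4, 1/4, 1/2] : Fin 3 → ℝ) 1 = 1/2 := by
    simp; norm_num
  have h1 := aux_key S hsym hsub hadd _ hP 0 1 (by decide) q r hq hr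
    (by rw [e]; exact aux_mix_mem q r _ hq hr (by norm_num) (by norm_num))
  have h2 := aux_key S hsym hsub hadd _ hP 0 1 (by decide) r q hr hq
    (by rw [e]; exact aux_mix_mem r q _ hr hq (by norm_num) (by norm_num))
  rw [e, show r + 1 / 2 * (q - r) = (q + r) / 2 by ring] at h1
  rw [e, show q + 1 / 2 * (r - q) = (q + r) / 2 by ring] at h2
  show S 2 ![1 - q, q] + S 2 ![1 - r, r] ≤ 2 * S 2 ![1 - (q + r) / 2, (q + r) / 2]
  linarith

theorem aux_pair_le {n : ℕ} (P : Fin n → ℝ) (hP : IsPosProbDist P) (i j : Fin n) (hij : i ≠ j) :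
    P i + P j ≤ 1 := by
  have h := hP.2
  rw [aux_sum_split i j hij] at h
  have : 0 ≤ ∑ k ∈ (Finset.univ.erase i).erase j, P k := Finset.sum_nonneg fun k _ => (hP.1 k).le
  linarith

theorem aux_mv_const (S : ∀ n : ℕ, (Fin n → ℝ) → ℝ) (hcont : ContinuousS S)
    (hsym : SymmetricS S) (hsub : SubadditiveS S) (hadd : AdditiveS S)
    {n : ℕ} (P : Fin n → ℝ) (hP : IsPosProbDist P) (i j : Fin n) (hij : i ≠ j)
    (a b : ℝ) (ha : a ∈ Set.Ioo (0:ℝ) 1) (hb : b ∈ Set.Ioo (0:ℝ) 1) :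
    S n (auxMv P i j a) - (P i + P j) * S 2 ![1 - a, a] =
      S n (auxMv P i j b) - (P i + P j) * S 2 ![1 - b, b] := by
  obtain ⟨φ, -, hφ⟩ := aux_rightDeriv _ (aux_f_conc S hcont hsym hsub hadd)
  have hp0 : 0 ≤ P i + P j := add_nonneg (hP.1 i).le (hP.1 j).le
  have hp1 := aux_pair_le P hP i j hij
  refine aux_const (fun t => S n (auxMv P i j t) - (P i + P j) * S 2 ![1 - t, t]) ?_ ?_ a b ha hb
  · exact (aux_mv_cont S hcont P hP i j hij).sub ((aux_f_cont S hcont).const_mul _)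
  · intro r hr
    have h1 := aux_squeeze _ (fun t => S n (auxMv P i j t)) (P i + P j) (φ r) r 1 hp0 hp1 hr.2
      (hφ r hr) (by
        intro q hq
        have hq' : q ∈ Set.Ioo (0:ℝ) 1 := ⟨hr.1.trans hq.1, hq.2⟩
        have := aux_key S hsym hsub hadd P hP i j hij r q hr hq' (aux_mix_mem _ _ _ hr hq' hp0 hp1)
        linarith) (by
        intro q hq
        have hq' : q ∈ Set.Ioo (0:ℝ) 1 := ⟨hr.1.trans hq.1, hq.2⟩
        have := aux_key S hsym hsub hadd P hP i j hij q r hq' hr (aux_mix_mem _ _ _ hq' hr hp0 hp1)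
        linarith)
    have h2 := h1.sub ((hφ r hr).const_mul (P i + P j))
    rw [sub_self] at h2
    exact h2

theorem aux_transfer (S : ∀ n : ℕ, (Fin n → ℝ) → ℝ) (hcont : ContinuousS S)
    (hsym : SymmetricS S) (hsub : SubadditiveS S) (hadd : AdditiveS S)
    {n : ℕ} (P Q : Fin n → ℝ) (hP : IsPosProbDist P) (hQ : IsPosProbDist Q)
    (i j : Fin n) (hij : i ≠ j) (hPQ : ∀ k, k ≠ i → k ≠ j → Q k = P k) :
    Q i + Q j = P i + P j ∧
    S n P - auxF (fun t => S 2 ![1 - t, t]) (P i) (P j) =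
      S n Q - auxF (fun t => S 2 ![1 - t, t]) (Q i) (Q j) := by
  have hs : Q i + Q j = P i + P j := by
    have h1 := hP.2
    have h2 := hQ.2
    rw [aux_sum_split i j hij] at h1 h2
    rw [aux_sum_rest i j _ _ hPQ] at h2
    linarith
  refine ⟨hs, ?_⟩
  have p1 := hP.1 i
  have p2 := hP.1 j
  have q1 := hQ.1 i
  have q2 := hQ.1 j
  have hp : 0 < P i + P j := by linarith
  have eP : auxMv P i j (P j / (P i + P j)) = P := by
    funext k
    unfold auxMv
    split_ifs with h1 h2
    · subst h1; field_simp; ring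
    · subst h2; field_simp
    · rfl
  have eQ : auxMv P i j (Q j / (P i + P j)) = Q := by
    funext k
    unfold auxMv
    split_ifs with h1 h2
    · subst h1; field_simp; linarith
    · subst h2; field_simp
    · exact (hPQ k h1 h2).symm
  have := aux_mv_const S hcont hsym hsub hadd P hP i j hij (P j / (P i + P j)) (Q j / (P i + P j))
    ⟨by positivity, by rw [div_lt_one hp]; linarith⟩
    ⟨by positivity, by rw [div_lt_one hp]; linarith⟩
  rw [eP, eQ] at this
  simp only [auxF, hs]
  exact this

theorem aux_f_form (S : ∀ n : ℕ, (Fin n → ℝ) → ℝ) (hcont : ContinuousS S)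
    (hsym : SymmetricS S) (hsub : SubadditiveS S) (hadd : AdditiveS S) :
    ∃ c : ℝ, 0 ≤ c ∧ ∃ k : ℝ, ∀ t ∈ Set.Ioo (0:ℝ) 1, S 2 ![1 - t, t] = c * Real.binEntropy t + k := by
  refine aux_FE (fun t => S 2 ![1 - t, t]) (aux_f_cont S hcont) (aux_f_conc S hcont hsym hsub hadd)
    (fun t ht => aux_f_symm S hsym t ht) ?_
  intro x y z hx hy hz hs ε h0 hεy hεz
  have pos : ∀ a b c : ℝ, 0 < a → 0 < b → 0 < c → a + b + c = 1 →
      IsPosProbDist (![a, b, c] : Fin 3 → ℝ) := by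
    intro a b c ha hb hc h
    refine ⟨fun k => ?_, by simp [Fin.sum_univ_three, h]⟩
    fin_cases k <;> simp [ha, hb, hc]
  have p0 := pos x y z hx hy hz hs
  have p1 := pos (x + ε) (y - ε) z (by linarith) (by linarith) hz (by linarith)
  have p2 := pos (x + ε) y (z - ε) (by linarith) hy (by linarith) (by linarith)
  have t1 := (aux_transfer S hcont hsym hsub hadd _ _ p0 p1 1 0 (by decide) (by
    intro k h1 h2; fin_cases k <;> simp_all)).2
  have t2 := (aux_transfer S hcont hsym hsub hadd _ _ p0 p2 2 0 (by decide) (by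
    intro k h1 h2; fin_cases k <;> simp_all)).2
  have t3 := (aux_transfer S hcont hsym hsub hadd _ _ p1 p2 1 2 (by decide) (by
    intro k h1 h2; fin_cases k <;> simp_all)).2
  have e : auxF (fun t => S 2 ![1 - t, t]) y (z - ε) = auxF (fun t => S 2 ![1 - t, t]) (z - ε) y := by
    simp only [auxF]
    have hz' : 0 < z - ε := by linarith
    rw [← aux_f_symm S hsym ((z - ε) / (y + (z - ε)))
      ⟨by positivity, by rw [div_lt_one (by positivity)]; linarith⟩,
      show 1 - (z - ε) / (y + (z - ε)) = y / (z - ε + y) by field_simp; ring]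
    ring
  simp at t1 t2 t3
  rw [← e]
  linarith

theorem aux_F_bin (a b : ℝ) (ha : 0 < a) (hb : 0 < b) :
    auxF Real.binEntropy a b =
      -(a * Real.log a) - b * Real.log b + (a + b) * Real.log (a + b) := by
  have hs : 0 < a + b := by positivity
  rw [auxF, Real.binEntropy_eq_negMulLog_add_negMulLog_one_sub,
    show 1 - b / (a + b) = a / (a + b) by field_simp; ring, Real.negMulLog, Real.negMulLog,
    Real.log_div hb.ne' hs.ne', Real.log_div ha.ne' hs.ne']
  field_simp
  ring

theorem aux_D (S : ∀ n : ℕ, (Fin n → ℝ) → ℝ) (hcont : ContinuousS S)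
    (hsym : SymmetricS S) (hsub : SubadditiveS S) (hadd : AdditiveS S) (c k : ℝ)
    (hf : ∀ t ∈ Set.Ioo (0:ℝ) 1, S 2 ![1 - t, t] = c * Real.binEntropy t + k)
    {n : ℕ} (P Q : Fin n → ℝ) (hP : IsPosProbDist P) (hQ : IsPosProbDist Q)
    (i j : Fin n) (hij : i ≠ j) (hPQ : ∀ k, k ≠ i → k ≠ j → Q k = P k) :
    S n P - c * shannonEntropy P = S n Q - c * shannonEntropy Q := by
  obtain ⟨hs, ht⟩ := aux_transfer S hcont hsym hsub hadd P Q hP hQ i j hij hPQ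
  have hF : ∀ a b : ℝ, 0 < a → 0 < b → auxF (fun t => S 2 ![1 - t, t]) a b =
      c * (-(a * Real.log a) - b * Real.log b + (a + b) * Real.log (a + b)) + k * (a + b) := by
    intro a b ha hb
    rw [← aux_F_bin a b ha hb]
    simp only [auxF]
    rw [hf _ ⟨by positivity, by rw [div_lt_one (by positivity)]; linarith⟩]
    ring
  rw [hF _ _ (hP.1 i) (hP.1 j), hF _ _ (hQ.1 i) (hQ.1 j), hs] at ht
  have hH : ∀ R : Fin n → ℝ, shannonEntropy R = -(R i * Real.log (R i)) - R j * Real.log (R j)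
      - ∑ k ∈ (Finset.univ.erase i).erase j, R k * Real.log (R k) := by
    intro R
    rw [shannonEntropy, aux_sum_split i j hij]; ring
  rw [hH P, hH Q, aux_sum_rest i j (fun k => Q k * Real.log (Q k)) (fun k => P k * Real.log (P k))
    (fun k h1 h2 => by rw [hPQ k h1 h2])]
  linear_combination ht

theorem aux_unif (n : ℕ) (hn : 0 < n) : IsPosProbDist (fun _ : Fin n => (1 / n : ℝ)) := by
  have : (0:ℝ) < n := by exact_mod_cast hn
  refine ⟨fun _ => by positivity, ?_⟩
  simp
  field_simp

theorem aux_to_unif {n : ℕ} (hn : 0 < n) (D : (Fin n → ℝ) → ℝ)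
    (hD : ∀ P Q : Fin n → ℝ, IsPosProbDist P → IsPosProbDist Q →
      ∀ i j : Fin n, i ≠ j → (∀ k, k ≠ i → k ≠ j → Q k = P k) → D P = D Q)
    (P : Fin n → ℝ) (hP : IsPosProbDist P) : D P = D (fun _ => 1 / n) := by
  classical
  have hU := aux_unif n hn
  induction hm : (Finset.univ.filter fun k => P k ≠ 1 / n).card using Nat.strong_induction_on
    generalizing P with
  | _ m ih =>
  by_cases hne : ∀ k, P k = 1 / n
  · congr 1; funext k; exact hne k
  have hsum : ∑ k, P k = ∑ k : Fin n, (1 / n : ℝ) := by rw [hP.2, hU.2]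
  have hi : ∃ i, P i < 1 / n := by
    by_contra hcon
    push Not at hcon
    refine hne fun k => ?_
    exact ((Finset.sum_eq_sum_iff_of_le (fun i _ => hcon i)).1 hsum.symm k (Finset.mem_univ k)).symm
  have hj : ∃ j, 1 / n < P j := by
    by_contra hcon
    push Not at hcon
    refine hne fun k => ?_
    exact ((Finset.sum_eq_sum_iff_of_le (fun i _ => hcon i)).1 hsum k (Finset.mem_univ k))
  obtain ⟨i, hi⟩ := hi
  obtain ⟨j, hj⟩ := hj
  have hij : i ≠ j := by rintro rfl; linarith
  set Q : Fin n → ℝ := fun k => if k = i then 1 / n else if k = j then P i + P j - 1 / n else P k with hQ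
  have Qi : Q i = 1 / n := by simp [hQ]
  have Qj : Q j = P i + P j - 1 / n := by simp [hQ, hij.symm]
  have Qk : ∀ k, k ≠ i → k ≠ j → Q k = P k := by intro k h1 h2; simp [hQ, h1, h2]
  have hQpos : IsPosProbDist Q := by
    refine ⟨fun k => ?_, ?_⟩
    · by_cases h1 : k = i
      · rw [h1, Qi]; exact hU.1 i
      by_cases h2 : k = j
      · rw [h2, Qj]; linarith [hP.1 i]
      rw [Qk k h1 h2]; exact hP.1 k
    · have := hP.2
      rw [aux_sum_split i j hij] at this ⊢
      rw [aux_sum_rest i j _ _ Qk, Qi, Qj]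
      linarith
  rw [hD P Q hP hQpos i j hij Qk]
  refine ih _ ?_ Q hQpos rfl
  rw [← hm]
  apply Finset.card_lt_card
  rw [Finset.ssubset_iff_of_subset]
  · exact ⟨i, by simpa using hi.ne, by simp [Qi]⟩
  · intro k
    simp only [Finset.mem_filter, Finset.mem_univ, true_and]
    intro h
    by_cases h1 : k = i
    · exact absurd (h1 ▸ Qi) h
    by_cases h2 : k = j
    · rw [h2]; exact hj.ne'
    rwa [← Qk k h1 h2]

theorem aux_ent_equiv {ι κ : Type*} [Fintype ι] [Fintype κ] (p : ι → ℝ) (e : κ ≃ ι) :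
    shannonEntropy (fun x => p (e x)) = shannonEntropy p := by
  simp only [shannonEntropy]
  rw [Equiv.sum_comp e (fun i => p i * Real.log (p i))]

theorem aux_ent_kron {ι κ : Type*} [Fintype ι] [Fintype κ] (p : ι → ℝ) (q : κ → ℝ)
    (hp : IsPosProbDist p) (hq : IsPosProbDist q) :
    shannonEntropy (kron p q) = shannonEntropy p + shannonEntropy q := by
  simp only [shannonEntropy, kron]
  rw [Fintype.sum_prod_type]
  have : ∀ i, ∑ j, p i * q j * Real.log (p i * q j) =
      p i * Real.log (p i) + p i * ∑ j, q j * Real.log (q j) := by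
    intro i
    have h : ∀ j, p i * q j * Real.log (p i * q j) =
        p i * Real.log (p i) * q j + p i * (q j * Real.log (q j)) := by
      intro j
      rw [Real.log_mul (hp.1 i).ne' (hq.1 j).ne']; ring
    simp only [h]
    rw [Finset.sum_add_distrib, ← Finset.mul_sum, ← Finset.mul_sum, hq.2, mul_one]
  simp only [this]
  rw [Finset.sum_add_distrib, ← Finset.sum_mul, hp.2]
  ring

theorem aux_ent_sub {m n : ℕ} (P : Fin m × Fin n → ℝ) (hP : IsPosProbDist P)
    (p : Fin m → ℝ) (q : Fin n → ℝ) (hp : IsPosProbDist p) (hq : IsPosProbDist q)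
    (ep : p = fun i => ∑ j, P (i, j)) (eq : q = fun j => ∑ i, P (i, j)) :
    shannonEntropy P ≤ shannonEntropy (kron p q) := by
  rw [aux_ent_kron p q hp hq]
  have h1 : ∑ i, p i * Real.log (p i) = ∑ x : Fin m × Fin n, P x * Real.log (p x.1) := by
    rw [Fintype.sum_prod_type]
    refine Finset.sum_congr rfl fun i _ => ?_
    have e : p i = ∑ j, P (i, j) := congrFun ep i
    show p i * Real.log (p i) = ∑ y, P (i, y) * Real.log (p i)
    rw [← Finset.sum_mul, ← e]
  have h2 : ∑ j, q j * Real.log (q j) = ∑ x : Fin m × Fin n, P x * Real.log (q x.2) := by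
    rw [Fintype.sum_prod_type_right]
    refine Finset.sum_congr rfl fun j _ => ?_
    have e : q j = ∑ i, P (i, j) := congrFun eq j
    show q j * Real.log (q j) = ∑ x, P (x, j) * Real.log (q j)
    rw [← Finset.sum_mul, ← e]
  have h3 : ∀ x : Fin m × Fin n, P x * Real.log (p x.1) + P x * Real.log (q x.2)
      - P x * Real.log (P x) ≤ kron p q x - P x := by
    intro x
    have a := hp.1 x.1
    have b := hq.1 x.2
    have c := hP.1 x
    have h := Real.log_le_sub_one_of_pos (x := p x.1 * q x.2 / P x) (by positivity)
    rw [Real.log_div (by positivity) c.ne', Real.log_mul a.ne' b.ne'] at h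
    have := mul_le_mul_of_nonneg_left h c.le
    have e : P x * (p x.1 * q x.2 / P x - 1) = kron p q x - P x := by
      simp only [kron]; field_simp
    linarith
  have h4 := Finset.sum_le_sum fun x (_ : x ∈ Finset.univ) => h3 x
  rw [Finset.sum_sub_distrib, Finset.sum_sub_distrib, Finset.sum_add_distrib,
    (aux_kron_pos p q hp hq).2, hP.2, ← h1, ← h2] at h4
  simp only [shannonEntropy]
  linarith

theorem aux_n_pos {n : ℕ} (p : Fin n → ℝ) (hp : IsPosProbDist p) : 0 < n := by
  rcases Nat.eq_zero_or_pos n with h | h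
  · subst h; have := hp.2; simp at this
  · exact h

/-- A continuous function `S` on the positive distributions is symmetric,
subadditive and additive iff `S(p) = c·H(p) + c_n` on `Δ_n⁺` for some constant `c ≥ 0`
and constants `c_n` with `c_{mn} = c_m + c_n`. -/
theorem shannon_characterization (S : ∀ n : ℕ, (Fin n → ℝ) → ℝ)
    (hcont : ContinuousS S) :
    (SymmetricS S ∧ SubadditiveS S ∧ AdditiveS S) ↔
      ∃ c : ℝ, 0 ≤ c ∧ ∃ cc : ℕ → ℝ,
        (∀ m n : ℕ, 0 < m → 0 < n → cc (m * n) = cc m + cc n) ∧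
        ∀ (n : ℕ) (p : Fin n → ℝ), IsPosProbDist p →
          S n p = c * shannonEntropy p + cc n := by
  constructor
  · rintro ⟨hsym, hsub, hadd⟩
    obtain ⟨c, hc, k, hf⟩ := aux_f_form S hcont hsym hsub hadd
    have hmain : ∀ (n : ℕ) (p : Fin n → ℝ), IsPosProbDist p →
        S n p - c * shannonEntropy p = S n (fun _ => 1 / n) - c * shannonEntropy (fun _ : Fin n => (1 / n : ℝ)) := by
      intro n p hp
      exact aux_to_unif (aux_n_pos p hp) (fun p => S n p - c * shannonEntropy p)
        (fun P Q hP hQ i j hij h => aux_D S hcont hsym hsub hadd c k hf P Q hP hQ i j hij h) p hp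
    refine ⟨c, hc, fun n => S n (fun _ => 1 / n) - c * shannonEntropy (fun _ : Fin n => (1 / n : ℝ)), ?_, ?_⟩
    · intro m n hm hn
      have um := aux_unif m hm
      have un := aux_unif n hn
      have h1 := hadd m n _ _ um un
      have h2 := hmain (m * n) _ (aux_comp_pos _ (aux_kron_pos _ _ um un) finProdFinEquiv.symm)
      rw [aux_ent_equiv, aux_ent_kron _ _ um un, h1] at h2
      show S (m * n) (fun _ => 1 / ((m * n : ℕ) : ℝ)) - c * shannonEntropy (fun _ : Fin (m * n) => 1 / ((m * n : ℕ) : ℝ)) = _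
      linarith
    · intro n p hp
      have := hmain n p hp
      show _ = _ + (S n (fun _ => 1 / n) - c * shannonEntropy (fun _ : Fin n => (1 / n : ℝ)))
      linarith
  · rintro ⟨c, hc, cc, hcc, hS⟩
    refine ⟨?_, ?_, ?_⟩
    · intro n p hp σ
      rw [hS n (p ∘ σ) (aux_comp_pos p hp σ), hS n p hp]
      rw [show shannonEntropy (p ∘ σ) = shannonEntropy p from aux_ent_equiv p σ]
    · intro m n P hP
      have hmn := aux_n_pos _ (aux_comp_pos P hP finProdFinEquiv.symm)
      have hm : 0 < m := Nat.pos_of_mul_pos_right hmn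
      have hn : 0 < n := Nat.pos_of_mul_pos_left hmn
      have hp : IsPosProbDist (fun i => ∑ j, P (i, j)) :=
        ⟨fun i => Finset.sum_pos (fun j _ => hP.1 _) ⟨⟨0, hn⟩, Finset.mem_univ _⟩,
          by rw [← Fintype.sum_prod_type]; exact hP.2⟩
      have hq : IsPosProbDist (fun j => ∑ i, P (i, j)) :=
        ⟨fun i => Finset.sum_pos (fun j _ => hP.1 _) ⟨⟨0, hm⟩, Finset.mem_univ _⟩,
          by rw [← Fintype.sum_prod_type_right]; exact hP.2⟩
      rw [hS _ _ (aux_comp_pos P hP finProdFinEquiv.symm),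
        hS _ _ (aux_comp_pos _ (aux_kron_pos _ _ hp hq) finProdFinEquiv.symm),
        aux_ent_equiv, aux_ent_equiv]
      have := mul_le_mul_of_nonneg_left (aux_ent_sub P hP _ _ hp hq rfl rfl) hc
      linarith
    · intro m n p q hp hq
      rw [hS _ _ (aux_comp_pos _ (aux_kron_pos _ _ hp hq) finProdFinEquiv.symm), hS m p hp, hS n q hq,
        aux_ent_equiv, aux_ent_kron p q hp hq, hcc m n (aux_n_pos p hp) (aux_n_pos q hq)]
      ring
end

section
/- (Klimesh–Turgut trumping criterion.) Let p, q ∈ ℝ^m be probability distributions with p↓ ≠ q↓ such that at least one of p, q has full rank. Then p ≻_T q if and only if H_α(p) < H_α(q) for all α ∈ ℝ∖{0} and H_Burg(p) < H_Burg(q). -/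
open scoped BigOperators

theorem tc_exists_top {ι : Type*} [Fintype ι] (P : ι → ℝ) (hP : ∀ i, 0 ≤ P i) (k : ℕ)
    (hk : k ≤ Fintype.card ι) :
    ∃ (B : Finset ι) (t : ℝ), 0 ≤ t ∧ B.card = k ∧ (∀ i ∈ B, t ≤ P i) ∧ (∀ i, i ∉ B → P i ≤ t) := by
  classical
  induction k with
  | zero =>
    refine ⟨∅, ∑ i, P i, Finset.sum_nonneg fun i _ => hP i, rfl, by simp, fun i _ => ?_⟩
    exact Finset.single_le_sum (fun i _ => hP i) (Finset.mem_univ i)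
  | succ k ih =>
    obtain ⟨B, t, ht, hB, h1, h2⟩ := ih (by omega)
    have hne : (Finset.univ \ B).Nonempty := by
      rw [← Finset.card_pos, Finset.card_sdiff_of_subset (Finset.subset_univ _), Finset.card_univ]
      omega
    obtain ⟨i, hi, hmax⟩ := Finset.exists_max_image _ P hne
    simp only [Finset.mem_sdiff, Finset.mem_univ, true_and] at hi hmax
    refine ⟨insert i B, P i, hP i, by rw [Finset.card_insert_of_notMem hi, hB], ?_, ?_⟩
    · intro j hj
      rcases Finset.mem_insert.1 hj with rfl | hj
      · exact le_rfl
      · exact (h2 i hi).trans (h1 j hj)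
    · intro j hj
      exact hmax j (fun h => hj (Finset.mem_insert_of_mem h))

theorem tc_maj_of_pot {ι κ : Type*} [Fintype ι] [Fintype κ] (P : ι → ℝ) (Q : κ → ℝ)
    (hP : ∀ i, 0 ≤ P i)
    (h : ∀ t, 0 ≤ t → ∑ j, max (Q j - t) 0 ≤ ∑ i, max (P i - t) 0) : Majorizes P Q := by
  classical
  intro A
  have key : ∀ t, ∑ j ∈ A, Q j ≤ ∑ j, max (Q j - t) 0 + A.card * t := by
    intro t
    have h1 : ∑ j ∈ A, (Q j - t) ≤ ∑ j, max (Q j - t) 0 :=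
      (Finset.sum_le_sum fun j _ => le_max_left _ _).trans
        (Finset.sum_le_sum_of_subset_of_nonneg (Finset.subset_univ _)
          fun j _ _ => le_max_right _ _)
    rw [Finset.sum_sub_distrib, Finset.sum_const, nsmul_eq_mul] at h1
    linarith
  by_cases hk : A.card ≤ Fintype.card ι
  · obtain ⟨B, t, ht, hB, h1, h2⟩ := tc_exists_top P hP A.card hk
    refine ⟨B, hB.le, (key t).trans ?_⟩
    have h3 : ∑ i, max (P i - t) 0 = ∑ i ∈ B, (P i - t) := by
      rw [← Finset.sum_subset (Finset.subset_univ B)]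
      · exact Finset.sum_congr rfl fun i hi => max_eq_left (by linarith [h1 i hi])
      · intro i _ hi
        exact max_eq_right (by linarith [h2 i hi])
    have := h t ht
    rw [h3, Finset.sum_sub_distrib, Finset.sum_const, nsmul_eq_mul, hB] at this
    linarith
  · refine ⟨Finset.univ, by rw [Finset.card_univ]; omega, (key 0).trans ?_⟩
    have := h 0 le_rfl
    have h3 : ∑ i, max (P i - 0) 0 = ∑ i, P i :=
      Finset.sum_congr rfl fun i _ => by rw [sub_zero]; exact max_eq_left (hP i)
    linarith

theorem tc_pot_of_maj {ι κ : Type*} [Fintype ι] [Fintype κ] (P : ι → ℝ) (Q : κ → ℝ)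
    (h : Majorizes P Q) (t : ℝ) (ht : 0 ≤ t) :
    ∑ j, max (Q j - t) 0 ≤ ∑ i, max (P i - t) 0 := by
  classical
  obtain ⟨B, hB, hs⟩ := h (Finset.univ.filter fun j => t ≤ Q j)
  set A := Finset.univ.filter fun j => t ≤ Q j with hA
  have h3 : ∑ j, max (Q j - t) 0 = ∑ j ∈ A, (Q j - t) := by
    rw [hA, Finset.sum_filter]
    refine Finset.sum_congr rfl fun j _ => ?_
    split_ifs with hj
    · exact max_eq_left (by linarith)
    · exact max_eq_right (by linarith)
  have h1 : ∑ j ∈ B, (P j - t) ≤ ∑ j, max (P j - t) 0 :=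
      (Finset.sum_le_sum fun j _ => le_max_left _ _).trans
        (Finset.sum_le_sum_of_subset_of_nonneg (Finset.subset_univ _)
          fun j _ _ => le_max_right _ _)
  rw [h3]
  refine le_trans ?_ h1
  rw [Finset.sum_sub_distrib, Finset.sum_const, nsmul_eq_mul, Finset.sum_sub_distrib,
    Finset.sum_const, nsmul_eq_mul]
  have : (B.card : ℝ) * t ≤ A.card * t :=
    mul_le_mul_of_nonneg_right (by exact_mod_cast hB) ht
  linarith

/-- Polya form, in normalised variables. -/
noncomputable def tcForm (d : ℕ) (f : ℕ → ℝ) (u τ : ℝ) : ℝ :=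
  ∑ j ∈ Finset.range (d + 1), f j *
    ((∏ i ∈ Finset.range j, (u - i * τ)) * ∏ i ∈ Finset.range (d - j), (1 - u - i * τ))

theorem tc_descFactorial (n T : ℕ) (hT : 0 < T) (j : ℕ) :
    (n.descFactorial j : ℝ) =
      (T : ℝ) ^ j * ∏ i ∈ Finset.range j, ((n : ℝ) / T - i * (1 / T)) := by
  have hT' : (T : ℝ) ≠ 0 := by positivity
  induction j with
  | zero => simp
  | succ j ih =>
    rw [Nat.descFactorial_succ, Finset.prod_range_succ, pow_succ]
    push_cast
    have h1 : ((n - j : ℕ) : ℝ) * (n.descFactorial j : ℝ) = ((n : ℝ) - j) * n.descFactorial j := by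
      by_cases h : j ≤ n
      · rw [Nat.cast_sub h]
      · have : n.descFactorial j = 0 := Nat.descFactorial_eq_zero_iff_lt.2 (by omega)
        simp [this]
    rw [h1, ih]
    field_simp

/-- binomial coefficient identity behind Polya's theorem -/
theorem tc_choose (N n M d j : ℕ) (hM : n + M = N + d) (hj : j ≤ d) :
    ((if j ≤ n then N.choose (n - j) else 0 : ℕ)) * (n.factorial * M.factorial) =
      N.factorial * (n.descFactorial j * M.descFactorial (d - j)) := by
  split_ifs with h
  · by_cases h2 : n - j ≤ N
    · have e1 := Nat.choose_mul_factorial_mul_factorial h2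
      have e2 := Nat.factorial_mul_descFactorial h
      have h3 : d - j ≤ M := by omega
      have e3 := Nat.factorial_mul_descFactorial h3
      have h4 : M - (d - j) = N - (n - j) := by omega
      rw [h4] at e3
      rw [← e1, ← e2, ← e3]
      ring
    · rw [Nat.choose_eq_zero_of_lt (by omega),
        (Nat.descFactorial_eq_zero_iff_lt (n := M) (k := d - j)).2 (by omega)]
      simp
  · rw [(Nat.descFactorial_eq_zero_iff_lt (n := n) (k := j)).2 (by omega)]
    simp

theorem tc_conv_nonneg (d N n : ℕ) (f : ℕ → ℝ) (hn : n ≤ N + d) (hT : 0 < N + d)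
    (h : 0 ≤ tcForm d f ((n : ℝ) / ((N + d : ℕ) : ℝ)) (1 / ((N + d : ℕ) : ℝ))) :
    0 ≤ ∑ j ∈ Finset.range (d + 1), ((if j ≤ n then N.choose (n - j) else 0 : ℕ) : ℝ) * f j := by
  obtain ⟨M, hM⟩ := Nat.exists_eq_add_of_le hn
  set T := N + d with hTd
  have hT' : (T : ℝ) ≠ 0 := by positivity
  have e : (∑ j ∈ Finset.range (d + 1), ((if j ≤ n then N.choose (n - j) else 0 : ℕ) : ℝ) * f j)
      * (n.factorial * M.factorial) =
      (N.factorial * (T : ℝ) ^ d) * tcForm d f ((n : ℝ) / (T : ℝ)) (1 / (T : ℝ)) := by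
    rw [tcForm, Finset.sum_mul, Finset.mul_sum]
    refine Finset.sum_congr rfl fun j hj => ?_
    have hj' : j ≤ d := by simpa [Nat.lt_succ_iff] using hj
    have e1 : ((if j ≤ n then N.choose (n - j) else 0 : ℕ) : ℝ) * (n.factorial * M.factorial) =
      N.factorial * (n.descFactorial j * M.descFactorial (d - j)) := by
      exact_mod_cast tc_choose N n M d j (by omega) hj'
    rw [mul_right_comm, e1, tc_descFactorial n T hT, tc_descFactorial M T hT]
    have e2 : (M : ℝ) / T = 1 - n / T := by
      field_simp
      rw [hM]; push_cast; ring
    rw [e2]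
    have e3 : (T : ℝ) ^ d = T ^ j * T ^ (d - j) := by rw [← pow_add]; congr 1; omega
    rw [e3]; ring
  have h1 : 0 < (n.factorial * M.factorial : ℝ) := by positivity
  have h2 : 0 ≤ (N.factorial * (T : ℝ) ^ d) * tcForm d f ((n : ℝ) / (T : ℝ)) (1 / (T : ℝ)) :=
    mul_nonneg (by positivity) h
  rw [← e] at h2
  exact nonneg_of_mul_nonneg_left h2 h1

theorem tc_polya (g : ℝ → ℝ) (hg : Continuous g) (a ε : ℝ) (hε : 0 < ε) (d : ℕ)
    (hneg : ∀ y, y ≤ a → 0 ≤ g y) (hpos : ∀ y, a + (d + 1) * ε ≤ y → 0 ≤ g y)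
    (hform : ∀ x ∈ Set.Icc a (a + ε), ∀ u ∈ Set.Icc (0 : ℝ) 1,
      0 < ∑ j ∈ Finset.range (d + 1), g (x + j * ε) * (u ^ j * (1 - u) ^ (d - j))) :
    ∃ N : ℕ, ∀ x, 0 ≤ ∑ k ∈ Finset.range (N + 1), (N.choose k : ℝ) * g (x - k * ε) := by
  have hcont : Continuous fun z : (ℝ × ℝ) × ℝ =>
      tcForm d (fun j => g (z.1.1 + j * ε)) z.1.2 z.2 := by
    unfold tcForm
    fun_prop
  have hopen : IsOpen {z : (ℝ × ℝ) × ℝ | 0 < tcForm d (fun j => g (z.1.1 + j * ε)) z.1.2 z.2} :=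
    isOpen_lt continuous_const hcont
  obtain ⟨U, W, hU, hW, hUs, hWs, hUW⟩ := generalized_tube_lemma
    ((isCompact_Icc (a := a) (b := a + ε)).prod (isCompact_Icc (a := (0 : ℝ)) (b := 1)))
    (isCompact_singleton (x := (0 : ℝ))) hopen (by
      rintro ⟨⟨x, u⟩, τ⟩ ⟨⟨hx, hu⟩, hτ⟩
      have hτ : τ = 0 := hτ
      subst hτ
      simpa [tcForm] using hform x hx u hu)
  obtain ⟨δ, hδ, hδW⟩ := Metric.isOpen_iff.1 hW 0 (hWs rfl)
  obtain ⟨N, hN⟩ := exists_nat_gt (1 / δ)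
  have hNpos : (0 : ℝ) < N := lt_trans (by positivity) hN
  refine ⟨N, fun x => ?_⟩
  set n : ℤ := ⌊(x - a) / ε⌋ with hn
  set x0 : ℝ := x - n * ε with hx0
  have hx0a : a ≤ x0 := by
    have := Int.floor_le ((x - a) / ε)
    rw [le_div_iff₀ hε] at this
    rw [hx0]; linarith
  have hx0b : x0 ≤ a + ε := by
    have := (Int.lt_floor_add_one ((x - a) / ε)).le
    rw [div_le_iff₀ hε] at this
    rw [hx0]; linarith
  -- terms away from the window are nonnegative
  have hlow : ∀ k : ℕ, n < k → 0 ≤ g (x - k * ε) := by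
    intro k hk
    apply hneg
    have : (n : ℝ) + 1 ≤ k := by exact_mod_cast hk
    have : ((n : ℝ) + 1) * ε ≤ k * ε := mul_le_mul_of_nonneg_right this hε.le
    rw [hx0] at hx0b; linarith
  have hhigh : ∀ k : ℕ, (k : ℤ) + d < n → 0 ≤ g (x - k * ε) := by
    intro k hk
    apply hpos
    have : (k : ℝ) + d + 1 ≤ n := by exact_mod_cast hk
    have : ((k : ℝ) + d + 1) * ε ≤ n * ε := mul_le_mul_of_nonneg_right this hε.le
    rw [hx0] at hx0a; linarith
  by_cases h0 : n < 0
  · exact Finset.sum_nonneg fun k _ => mul_nonneg (by positivity) (hlow k (by omega))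
  obtain ⟨n', hn'⟩ := Int.eq_ofNat_of_zero_le (not_lt.1 h0)
  by_cases h1 : N + d < n'
  · refine Finset.sum_nonneg fun k hk => mul_nonneg (by positivity) (hhigh k ?_)
    have := Finset.mem_range.1 hk
    omega
  have hT : 0 < N + d := by
    have : 0 < N := by exact_mod_cast hNpos
    omega
  have hTr : (0 : ℝ) < ((N + d : ℕ) : ℝ) := by exact_mod_cast hT
  have key := tc_conv_nonneg d N n' (fun j => g (x0 + j * ε)) (not_lt.1 h1) hT (by
    have hm : ((x0, (n' : ℝ) / ((N + d : ℕ) : ℝ)), 1 / ((N + d : ℕ) : ℝ)) ∈ U ×ˢ W := by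
      refine ⟨hUs ⟨⟨hx0a, hx0b⟩, ⟨by positivity, ?_⟩⟩, hδW ?_⟩
      · rw [div_le_one hTr]
        exact_mod_cast not_lt.1 h1
      · rw [Metric.mem_ball, dist_zero_right, Real.norm_of_nonneg (by positivity)]
        rw [div_lt_comm₀ hTr hδ]
        refine hN.trans_le ?_
        push_cast; linarith [Nat.cast_nonneg (α := ℝ) d]
    exact (hUW hm).le)
  refine key.trans ?_
  classical
  -- compare the two sums
  have hsplit : ∑ k ∈ (Finset.range (N + 1)).filter (fun k => k ≤ n' ∧ n' ≤ k + d),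
      (N.choose k : ℝ) * g (x - k * ε) ≤
      ∑ k ∈ Finset.range (N + 1), (N.choose k : ℝ) * g (x - k * ε) := by
    refine Finset.sum_le_sum_of_subset_of_nonneg (Finset.filter_subset _ _) fun k hk hk2 => ?_
    refine mul_nonneg (by positivity) ?_
    simp only [Finset.mem_filter, hk, true_and, not_and_or, not_le] at hk2
    rcases hk2 with h | h
    · exact hlow k (by omega)
    · exact hhigh k (by omega)
  refine le_trans (le_of_eq ?_) hsplit
  have hfil : ∑ j ∈ Finset.range (d + 1),
      ((if j ≤ n' then N.choose (n' - j) else 0 : ℕ) : ℝ) * g (x0 + j * ε) =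
      ∑ j ∈ (Finset.range (d + 1)).filter (fun j => j ≤ n' ∧ n' ≤ N + j),
        ((if j ≤ n' then N.choose (n' - j) else 0 : ℕ) : ℝ) * g (x0 + j * ε) := by
    symm
    refine Finset.sum_subset (Finset.filter_subset _ _) fun j hj hj2 => ?_
    simp only [Finset.mem_filter, hj, true_and, not_and_or, not_le] at hj2
    rcases hj2 with h | h
    · rw [if_neg (by omega)]; simp
    · split_ifs
      · rw [Nat.choose_eq_zero_of_lt (by omega)]; simp
      · simp
  rw [hfil]
  refine Finset.sum_nbij' (fun j => n' - j) (fun k => n' - k) ?_ ?_ ?_ ?_ ?_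
  · intro j hj
    simp only [Finset.mem_filter, Finset.mem_range] at hj ⊢
    omega
  · intro j hj
    simp only [Finset.mem_filter, Finset.mem_range] at hj ⊢
    omega
  · intro j hj
    simp only [Finset.mem_filter, Finset.mem_range] at hj ⊢
    omega
  · intro j hj
    simp only [Finset.mem_filter, Finset.mem_range] at hj ⊢
    omega
  · intro j hj
    simp only [Finset.mem_filter, Finset.mem_range] at hj
    rw [if_pos hj.2.1]
    congr 2
    rw [hx0, hn', Nat.cast_sub hj.2.1]
    push_cast
    ring

theorem tc_weighted_pos (s t : Finset ℕ) (hts : t ⊆ s) (c E : ℕ → ℝ) (m0 C E1 E2 : ℝ)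
    (hm0 : 0 ≤ m0) (hC : 0 ≤ C) (hE1 : 0 ≤ E1) (hE2 : 0 ≤ E2) (hE : ∀ j ∈ s, 0 ≤ E j)
    (ht : ∀ j ∈ t, m0 ≤ c j ∧ E1 ≤ E j)
    (hs : ∀ j ∈ s, 0 ≤ c j ∨ (-C ≤ c j ∧ E j ≤ E2))
    (hlt : (s.card : ℝ) * (C * E2) < t.card * (m0 * E1)) :
    0 < ∑ j ∈ s, c j * E j := by
  have h1 : ∀ j ∈ s, (if j ∈ t then m0 * E1 else 0) - C * E2 ≤ c j * E j := by
    intro j hj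
    have hCE : 0 ≤ C * E2 := mul_nonneg hC hE2
    split_ifs with h
    · have := mul_le_mul (ht j h).1 (ht j h).2 hE1 (hm0.trans (ht j h).1)
      linarith
    · rcases hs j hj with h2 | ⟨h2, h3⟩
      · have := mul_nonneg h2 (hE j hj)
        linarith
      · have h4 : -C * E j ≤ c j * E j := mul_le_mul_of_nonneg_right h2 (hE j hj)
        have h5 : C * E j ≤ C * E2 := mul_le_mul_of_nonneg_left h3 hC
        linarith
  have h2 := Finset.sum_le_sum h1
  rw [Finset.sum_sub_distrib, ← Finset.sum_filter, Finset.sum_const, Finset.sum_const,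
    Finset.filter_mem_eq_inter, Finset.inter_eq_right.2 hts, nsmul_eq_mul, nsmul_eq_mul] at h2
  linarith

theorem tc_integral_cont (g : ℝ → ℝ) (hg : Continuous g) (a b : ℝ) :
    Continuous fun α : ℝ => ∫ y in a..b, g y * Real.exp (α * y) := by
  apply intervalIntegral.continuous_parametric_intervalIntegral_of_continuous'
  fun_prop

set_option maxHeartbeats 2000000 in
theorem tc_riemann (g : ℝ → ℝ) (hg : Continuous g) (a b η : ℝ) (hab : a < b) (hη : 0 < η)
    (hηb : η ≤ b - a)
    (hga : ∀ y ∈ Set.Icc a (a + η), 0 < g y) (hgb : ∀ y ∈ Set.Icc (b - η) b, 0 < g y)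
    (hI : ∀ α : ℝ, 0 < ∫ y in a..b, g y * Real.exp (α * y)) :
    ∃ (d : ℕ) (ε : ℝ), 0 < ε ∧ ε ≤ η ∧ a + (d + 1) * ε = b ∧
      ∀ x ∈ Set.Icc a (a + ε), ∀ α : ℝ,
        0 < ∑ j ∈ Finset.range (d + 1), g (x + j * ε) * Real.exp (α * (x + j * ε)) := by
  -- constants
  obtain ⟨C, hC⟩ := (isCompact_Icc (a := a) (b := b)).exists_bound_of_continuousOn hg.continuousOn
  have hC0 : 0 ≤ C := (norm_nonneg _).trans (hC a ⟨le_rfl, hab.le⟩)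
  obtain ⟨ya, hya, hya'⟩ := (isCompact_Icc (a := a) (b := a + η)).exists_isMinOn
    ⟨a, le_rfl, by linarith⟩ hg.continuousOn
  obtain ⟨yb, hyb, hyb'⟩ := (isCompact_Icc (a := b - η) (b := b)).exists_isMinOn
    ⟨b, by linarith, le_rfl⟩ hg.continuousOn
  set m0 := min (g ya) (g yb) with hm0
  have hm0p : 0 < m0 := lt_min (hga _ hya) (hgb _ hyb)
  have hma : ∀ y ∈ Set.Icc a (a + η), m0 ≤ g y := fun y hy => (min_le_left _ _).trans (hya' hy)
  have hmb : ∀ y ∈ Set.Icc (b - η) b, m0 ≤ g y := fun y hy => (min_le_right _ _).trans (hyb' hy)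
  obtain ⟨K, hK⟩ := exists_nat_gt ((b - a) / (η / 2))
  have hba : 0 < b - a := by linarith
  have hK0 : (0 : ℝ) < K := lt_trans (by positivity) hK
  have hK0' : 0 < K := by exact_mod_cast hK0
  have hKη : (b - a) / K ≤ η / 2 := by
    rw [div_lt_iff₀ (by positivity)] at hK
    rw [div_le_iff₀ hK0]; linarith
  obtain ⟨A, hA⟩ : ∃ A : ℝ, K * C < m0 * Real.exp (A * (η / 2)) := by
    refine ⟨(K * C / m0) / (η / 2), ?_⟩
    rw [div_mul_cancel₀ _ (by positivity)]
    have := Real.add_one_le_exp (K * C / m0)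
    have h2 : K * C / m0 < Real.exp (K * C / m0) := by linarith
    rwa [div_lt_iff₀' hm0p] at h2
  -- compact range of exponents
  have hIc := tc_integral_cont g hg a b
  obtain ⟨lam, hlam, hlam'⟩ : ∃ lam : ℝ, 0 < lam ∧ ∀ α ∈ Set.Icc (-A) A,
      lam ≤ ∫ y in a..b, g y * Real.exp (α * y) := by
    by_cases hne : (Set.Icc (-A) A).Nonempty
    · obtain ⟨α0, h0, h1⟩ := (isCompact_Icc (a := -A) (b := A)).exists_isMinOn hne hIc.continuousOn
      exact ⟨_, hI α0, fun α hα => h1 hα⟩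
    · exact ⟨1, one_pos, fun α hα => (hne ⟨α, hα⟩).elim⟩
  have huc : UniformContinuousOn (fun z : ℝ × ℝ => g z.2 * Real.exp (z.1 * z.2))
      (Set.Icc (-A) A ×ˢ Set.Icc a b) := by
    apply IsCompact.uniformContinuousOn_of_continuous (isCompact_Icc.prod isCompact_Icc)
    apply Continuous.continuousOn
    fun_prop
  rw [Metric.uniformContinuousOn_iff] at huc
  obtain ⟨δ, hδ, hδ'⟩ := huc (lam / (2 * (b - a))) (by positivity)
  obtain ⟨D, hD⟩ := exists_nat_gt ((b - a) / δ)
  have hD0 : (0 : ℝ) < D := lt_trans (by positivity) hD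
  have hD0' : 0 < D := by exact_mod_cast hD0
  have hKD : 0 < K * D := Nat.mul_pos hK0' hD0'
  have hKDr : (0 : ℝ) < (K : ℝ) * D := by positivity
  set ε := (b - a) / (K * D) with hε
  have hε0 : 0 < ε := by positivity
  have hD1 : (1 : ℝ) ≤ D := by exact_mod_cast hD0'
  have hK1 : (1 : ℝ) ≤ K := by exact_mod_cast hK0'
  have hDε : D * ε = (b - a) / K := by rw [hε]; field_simp
  have hKDε : (K * D) * ε = b - a := by rw [hε]; field_simp
  have hεη : ε ≤ η / 2 := by nlinarith
  have hεδ : ε < δ := by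
    rw [div_lt_iff₀ hδ] at hD
    have : D * ε < D * δ := by
      rw [hDε]
      refine lt_of_le_of_lt (div_le_self hba.le hK1) hD
    exact lt_of_mul_lt_mul_left this hD0.le
  have hd1 : K * D - 1 + 1 = K * D := by omega
  refine ⟨K * D - 1, ε, hε0, by linarith, ?_, ?_⟩
  · have : ((K * D - 1 : ℕ) : ℝ) + 1 = K * D := by exact_mod_cast hd1
    rw [this, hKDε]; ring
  intro x hx α
  rw [hd1]
  have hylo : ∀ j : ℕ, a + j * ε ≤ x + j * ε := fun j => by linarith [hx.1]
  have hyhi : ∀ j : ℕ, x + j * ε ≤ a + (j + 1) * ε := fun j => by linarith [hx.2]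
  have hcell : ∀ j ∈ Finset.range (K * D), a ≤ a + j * ε ∧ a + (j + 1) * ε ≤ b := by
    intro j hj
    have h1 : (j : ℝ) + 1 ≤ K * D := by exact_mod_cast Finset.mem_range.1 hj
    have h2 := mul_le_mul_of_nonneg_right h1 hε0.le
    have h3 : 0 ≤ j * ε := by positivity
    constructor <;> linarith
  have hmem : ∀ j ∈ Finset.range (K * D), x + j * ε ∈ Set.Icc a b := fun j hj =>
    ⟨(hcell j hj).1.trans (hylo j), (hyhi j).trans (hcell j hj).2⟩
  by_cases hα1 : A < α
  · -- large positive exponents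
    refine tc_weighted_pos (Finset.range (K * D)) (Finset.Ico (K * D - D) (K * D)) ?_
      (fun j => g (x + j * ε)) (fun j => Real.exp (α * (x + j * ε))) m0 C
      (Real.exp (α * (b - η / 2))) (Real.exp (α * (b - η))) hm0p.le hC0 (Real.exp_pos _).le
      (Real.exp_pos _).le (fun j _ => (Real.exp_pos _).le) ?_ ?_ ?_
    · intro j hj
      simp only [Finset.mem_Ico, Finset.mem_range] at *
      exact hj.2
    · intro j hj
      have hj' := Finset.mem_Ico.1 hj
      have h1 : (K : ℝ) * D ≤ j + D := by
        have : K * D ≤ j + D := by omega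
        exact_mod_cast this
      have h2 : b - η / 2 ≤ x + j * ε := by
        have := mul_le_mul_of_nonneg_right h1 hε0.le
        have := hylo j
        nlinarith
      have h3 := hmem j (Finset.mem_range.2 hj'.2)
      have hA0 : 0 ≤ α := by
        by_contra hneg
        have hA2 : A * (η / 2) ≤ 0 := by nlinarith
        have hexp : Real.exp (A * (η / 2)) ≤ 1 := Real.exp_le_one_iff.2 hA2
        have hm0C : m0 ≤ C := by
          have := hC a ⟨le_rfl, hab.le⟩
          exact (hma a ⟨le_rfl, by linarith⟩).trans ((le_abs_self _).trans this)
        nlinarith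
      exact ⟨hmb _ ⟨by linarith, h3.2⟩,
        Real.exp_le_exp.2 (mul_le_mul_of_nonneg_left h2 hA0)⟩
    · intro j hj
      by_cases h : b - η ≤ x + j * ε
      · exact Or.inl (hgb _ ⟨h, (hmem j hj).2⟩).le
      · have hA0 : 0 ≤ α := by
          by_contra hneg
          have hA2 : A * (η / 2) ≤ 0 := by nlinarith
          have hexp : Real.exp (A * (η / 2)) ≤ 1 := Real.exp_le_one_iff.2 hA2
          have hm0C : m0 ≤ C := by
            have := hC a ⟨le_rfl, hab.le⟩
            exact (hma a ⟨le_rfl, by linarith⟩).trans ((le_abs_self _).trans this)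
          nlinarith
        refine Or.inr ⟨?_, Real.exp_le_exp.2 (mul_le_mul_of_nonneg_left (not_le.1 h).le hA0)⟩
        have := hC _ (hmem j hj)
        exact (abs_le.1 this).1
    · rw [Finset.card_range, Nat.card_Ico]
      have : K * D - (K * D - D) = D := by
        have : D ≤ K * D := Nat.le_mul_of_pos_left _ hK0'
        omega
      rw [this]
      push_cast
      have e1 : Real.exp (α * (b - η / 2)) = Real.exp (α * (b - η)) * Real.exp (α * (η / 2)) := by
        rw [← Real.exp_add]; congr 1; ring
      rw [e1]
      have h2 : Real.exp (A * (η / 2)) ≤ Real.exp (α * (η / 2)) :=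
        Real.exp_le_exp.2 (mul_le_mul_of_nonneg_right hα1.le (by positivity))
      have h3 : K * C < m0 * Real.exp (α * (η / 2)) :=
        hA.trans_le (mul_le_mul_of_nonneg_left h2 hm0p.le)
      have h4 := mul_lt_mul_of_pos_left h3 (mul_pos hD0 (Real.exp_pos (α * (b - η))))
      linarith
  by_cases hα2 : α < -A
  · -- large negative exponents
    have hA0 : α ≤ 0 := by
      by_contra hneg
      have hA2 : A * (η / 2) ≤ 0 := by nlinarith
      have hexp : Real.exp (A * (η / 2)) ≤ 1 := Real.exp_le_one_iff.2 hA2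
      have hm0C : m0 ≤ C := by
        have := hC a ⟨le_rfl, hab.le⟩
        exact (hma a ⟨le_rfl, by linarith⟩).trans ((le_abs_self _).trans this)
      nlinarith
    refine tc_weighted_pos (Finset.range (K * D)) (Finset.range D) ?_
      (fun j => g (x + j * ε)) (fun j => Real.exp (α * (x + j * ε))) m0 C
      (Real.exp (α * (a + η / 2))) (Real.exp (α * (a + η))) hm0p.le hC0 (Real.exp_pos _).le
      (Real.exp_pos _).le (fun j _ => (Real.exp_pos _).le) ?_ ?_ ?_
    · intro j hj
      simp only [Finset.mem_range] at *
      exact hj.trans_le (Nat.le_mul_of_pos_left _ hK0')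
    · intro j hj
      have hj' := Finset.mem_range.1 hj
      have h1 : (j : ℝ) + 1 ≤ D := by exact_mod_cast hj'
      have h2 : x + j * ε ≤ a + η / 2 := by
        have := mul_le_mul_of_nonneg_right h1 hε0.le
        have := hyhi j
        nlinarith
      have h3 := hmem j (Finset.mem_range.2 (hj'.trans_le (Nat.le_mul_of_pos_left _ hK0')))
      exact ⟨hma _ ⟨h3.1, by linarith⟩,
        Real.exp_le_exp.2 (mul_le_mul_of_nonpos_left h2 hA0)⟩
    · intro j hj
      by_cases h : x + j * ε ≤ a + η
      · exact Or.inl (hga _ ⟨(hmem j hj).1, h⟩).le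
      · refine Or.inr ⟨?_, Real.exp_le_exp.2 (mul_le_mul_of_nonpos_left (not_le.1 h).le hA0)⟩
        have := hC _ (hmem j hj)
        exact (abs_le.1 this).1
    · rw [Finset.card_range, Finset.card_range]
      push_cast
      have e1 : Real.exp (α * (a + η / 2)) = Real.exp (α * (a + η)) * Real.exp (-α * (η / 2)) := by
        rw [← Real.exp_add]; congr 1; ring
      rw [e1]
      have h2 : Real.exp (A * (η / 2)) ≤ Real.exp (-α * (η / 2)) :=
        Real.exp_le_exp.2 (mul_le_mul_of_nonneg_right (by linarith) (by positivity))
      have h3 : K * C < m0 * Real.exp (-α * (η / 2)) :=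
        hA.trans_le (mul_le_mul_of_nonneg_left h2 hm0p.le)
      have h4 := mul_lt_mul_of_pos_left h3 (mul_pos hD0 (Real.exp_pos (α * (a + η))))
      linarith
  -- compact range
  have hαm : α ∈ Set.Icc (-A) A := ⟨not_lt.1 hα2, not_lt.1 hα1⟩
  have hcont : Continuous fun y => g y * Real.exp (α * y) := by fun_prop
  have hsum : ∑ j ∈ Finset.range (K * D),
      ∫ y in (a + j * ε)..(a + ((j + 1 : ℕ) : ℝ) * ε), g y * Real.exp (α * y) =
      ∫ y in a..b, g y * Real.exp (α * y) := by
    have := intervalIntegral.sum_integral_adjacent_intervals (n := K * D)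
      (a := fun j : ℕ => a + j * ε) (f := fun y => g y * Real.exp (α * y))
      (μ := MeasureTheory.volume) (fun k _ => hcont.intervalIntegrable _ _)
    rw [this]
    congr 1
    · simp
    · push_cast; rw [hKDε]; ring
  have hle : ∑ j ∈ Finset.range (K * D),
      ∫ y in (a + j * ε)..(a + ((j + 1 : ℕ) : ℝ) * ε), g y * Real.exp (α * y) ≤
      ∑ j ∈ Finset.range (K * D),
        ε * (g (x + j * ε) * Real.exp (α * (x + j * ε)) + lam / (2 * (b - a))) := by
    refine Finset.sum_le_sum fun j hj => ?_
    have hle1 : a + j * ε ≤ a + ((j + 1 : ℕ) : ℝ) * ε := by push_cast; linarith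
    have := intervalIntegral.integral_mono_on (μ := MeasureTheory.volume) hle1
      (hcont.intervalIntegrable _ _)
      (continuous_const (y := g (x + j * ε) * Real.exp (α * (x + j * ε)) + lam / (2 * (b - a)))
        |>.intervalIntegrable _ _) (by
        intro y hy
        have hy2 : y ≤ a + (j + 1) * ε := by have := hy.2; push_cast at this; exact this
        have hymem : y ∈ Set.Icc a b :=
          ⟨(hcell j hj).1.trans hy.1, hy2.trans (hcell j hj).2⟩
        have hdist := hδ' (α, y) ⟨hαm, hymem⟩ (α, x + j * ε) ⟨hαm, hmem j hj⟩ (by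
          rw [Prod.dist_eq, dist_self, max_eq_right dist_nonneg, Real.dist_eq]
          have h1 := hylo j
          have h2 := hyhi j
          have h3 := hy.1
          refine lt_of_le_of_lt (abs_le.2 ⟨?_, ?_⟩) hεδ <;> linarith)
        rw [Real.dist_eq] at hdist
        have := (abs_lt.1 hdist).2
        simp only at this
        linarith)
    rw [intervalIntegral.integral_const, smul_eq_mul] at this
    refine this.trans (le_of_eq ?_)
    push_cast; ring
  rw [hsum, ← Finset.mul_sum, Finset.sum_add_distrib, Finset.sum_const, Finset.card_range,
    nsmul_eq_mul] at hle
  have h1 := hlam' α hαm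
  have h2 : ε * (((K * D : ℕ) : ℝ) * (lam / (2 * (b - a)))) = lam / 2 := by
    push_cast
    have : ε * (K * D * (lam / (2 * (b - a)))) = ((K * D) * ε) * (lam / (2 * (b - a))) := by ring
    rw [this, hKDε]; field_simp
  rw [mul_add, h2] at hle
  have h3 : 0 < ε * ∑ j ∈ Finset.range (K * D), g (x + j * ε) * Real.exp (α * (x + j * ε)) := by
    linarith
  exact (pos_iff_pos_of_mul_pos h3).1 hε0

theorem tc_catalyst (g : ℝ → ℝ) (hg : Continuous g) (a b η : ℝ) (hab : a < b) (hη : 0 < η)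
    (hηb : η ≤ b - a) (hneg : ∀ y, y ≤ a → 0 ≤ g y) (hpos : ∀ y, b ≤ y → 0 ≤ g y)
    (hga : ∀ y ∈ Set.Icc a (a + η), 0 < g y) (hgb : ∀ y ∈ Set.Icc (b - η) b, 0 < g y)
    (hI : ∀ α : ℝ, 0 < ∫ y in a..b, g y * Real.exp (α * y)) :
    ∃ (N : ℕ) (ε : ℝ), ∀ x,
      0 ≤ ∑ k ∈ Finset.range (N + 1), (N.choose k : ℝ) * g (x - k * ε) := by
  obtain ⟨d, ε, hε, hεη, hd, hsum⟩ := tc_riemann g hg a b η hab hη hηb hga hgb hI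
  obtain ⟨N, hN⟩ := tc_polya g hg a ε hε d hneg (by rw [hd]; exact hpos) (by
    intro x hx u hu
    rcases eq_or_lt_of_le hu.1 with h0 | h0
    · rw [← h0, Finset.sum_eq_single 0]
      · simpa using hga x ⟨hx.1, by linarith [hx.2]⟩
      · intro j _ hj; simp [hj]
      · simp
    rcases eq_or_lt_of_le hu.2 with h1 | h1
    · rw [h1, Finset.sum_eq_single d]
      · have : 0 < g (x + d * ε) := hgb _ ⟨by linarith [hx.1], by linarith [hx.2]⟩
        simpa using this
      · intro j hj hjd
        have : d - j ≠ 0 := by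
          have := Finset.mem_range.1 hj
          omega
        simp [this]
      · simp
    have hv : 0 < 1 - u := by linarith
    set α := Real.log (u / (1 - u)) / ε with hα
    have hX : u / (1 - u) = Real.exp (α * ε) := by
      rw [hα, div_mul_cancel₀ _ hε.ne', Real.exp_log (by positivity)]
    have e : ∑ j ∈ Finset.range (d + 1), g (x + j * ε) * (u ^ j * (1 - u) ^ (d - j)) =
        ((1 - u) ^ d * Real.exp (-(α * x))) *
          ∑ j ∈ Finset.range (d + 1), g (x + j * ε) * Real.exp (α * (x + j * ε)) := by
      rw [Finset.mul_sum]
      refine Finset.sum_congr rfl fun j hj => ?_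
      have hj' : j ≤ d := by simpa [Nat.lt_succ_iff] using hj
      have e1 : Real.exp (α * (x + j * ε)) = Real.exp (α * x) * (u / (1 - u)) ^ j := by
        rw [hX, ← Real.exp_nat_mul, ← Real.exp_add]; congr 1; ring
      have e2 : (1 - u) ^ d = (1 - u) ^ j * (1 - u) ^ (d - j) := by
        rw [← pow_add]; congr 1; omega
      rw [e1, e2, div_pow, Real.exp_neg]
      have := (Real.exp_pos (α * x)).ne'
      field_simp
    rw [e]
    exact mul_pos (by positivity) (hsum x hx α))
  exact ⟨N, ε, hN⟩

theorem tc_integral_mono_interval (h : ℝ → ℝ) (hh : Continuous h) (a' a b b' : ℝ)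
    (ha : a' ≤ a) (hb : b ≤ b')
    (h1 : ∀ y ∈ Set.Icc a' a, 0 ≤ h y) (h2 : ∀ y ∈ Set.Icc b b', 0 ≤ h y) :
    ∫ y in a..b, h y ≤ ∫ y in a'..b', h y := by
  have e1 := intervalIntegral.integral_add_adjacent_intervals (μ := MeasureTheory.volume)
    (hh.intervalIntegrable a' a) (hh.intervalIntegrable a b)
  have e2 := intervalIntegral.integral_add_adjacent_intervals (μ := MeasureTheory.volume)
    (hh.intervalIntegrable a' b) (hh.intervalIntegrable b b')
  have i1 : 0 ≤ ∫ y in a'..a, h y := intervalIntegral.integral_nonneg ha h1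
  have i2 : 0 ≤ ∫ y in b..b', h y := intervalIntegral.integral_nonneg hb h2
  linarith

/-- if the weight is large enough, the integral is positive (right end dominates) -/
theorem tc_large (g : ℝ → ℝ) (hg : Continuous g) (w2 w3 w4 : ℝ)
    (h34 : w3 < w4) (h23 : w2 ≤ w3)
    (hp3 : ∀ y ∈ Set.Icc w3 w4, 0 < g y) :
    ∃ A : ℝ, ∀ α, A ≤ α → 0 < ∫ y in w2..w4, g y * Real.exp (α * y) := by
  obtain ⟨C, hC⟩ := (isCompact_Icc (a := w2) (b := w3)).exists_bound_of_continuousOn hg.continuousOn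
  have hC0 : 0 ≤ C := (norm_nonneg _).trans (hC w2 ⟨le_rfl, h23⟩)
  obtain ⟨yb, hyb, hyb'⟩ := (isCompact_Icc (a := w3) (b := w4)).exists_isMinOn
    ⟨w3, le_rfl, h34.le⟩ hg.continuousOn
  set m0 := g yb with hm0
  have hm0p : 0 < m0 := hp3 _ hyb
  set w := (w3 + w4) / 2 with hw
  have hw3 : w3 < w := by rw [hw]; linarith
  have hw4 : w < w4 := by rw [hw]; linarith
  set R := C * (w3 - w2) / (m0 * (w4 - w)) with hR
  have hden : 0 < m0 * (w4 - w) := mul_pos hm0p (by linarith)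
  have hR0 : 0 ≤ R := div_nonneg (mul_nonneg hC0 (by linarith)) hden.le
  refine ⟨R / (w - w3), fun α hα => ?_⟩
  have hα0 : 0 ≤ α := (div_nonneg hR0 (by linarith)).trans hα
  have hαR : R < Real.exp (α * (w - w3)) := by
    rw [div_le_iff₀ (by linarith)] at hα
    have := Real.add_one_le_exp (α * (w - w3))
    linarith
  have hcont : Continuous fun y => g y * Real.exp (α * y) := by fun_prop
  have e1 := intervalIntegral.integral_add_adjacent_intervals (μ := MeasureTheory.volume)
    (hcont.intervalIntegrable w2 w3) (hcont.intervalIntegrable w3 w4)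
  have e2 := intervalIntegral.integral_add_adjacent_intervals (μ := MeasureTheory.volume)
    (hcont.intervalIntegrable w3 w) (hcont.intervalIntegrable w w4)
  have i1 : 0 ≤ ∫ y in w3..w, g y * Real.exp (α * y) :=
    intervalIntegral.integral_nonneg hw3.le fun y hy =>
      mul_nonneg (hp3 y ⟨hy.1, by linarith [hy.2]⟩).le (Real.exp_pos _).le
  have i2 : (w4 - w) * (m0 * Real.exp (α * w)) ≤ ∫ y in w..w4, g y * Real.exp (α * y) := by
    have := intervalIntegral.integral_mono_on (μ := MeasureTheory.volume) hw4.le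
      (continuous_const (y := m0 * Real.exp (α * w)) |>.intervalIntegrable _ _)
      (hcont.intervalIntegrable w w4) (by
        intro y hy
        have h1 : m0 ≤ g y := hyb' ⟨by linarith [hy.1], hy.2⟩
        exact mul_le_mul h1 (Real.exp_le_exp.2 (mul_le_mul_of_nonneg_left hy.1 hα0))
          (Real.exp_pos _).le (hm0p.le.trans h1))
    rwa [intervalIntegral.integral_const, smul_eq_mul] at this
  have i3 : (w3 - w2) * (-(C * Real.exp (α * w3))) ≤ ∫ y in w2..w3, g y * Real.exp (α * y) := by
    have := intervalIntegral.integral_mono_on (μ := MeasureTheory.volume) h23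
      (continuous_const (y := -(C * Real.exp (α * w3))) |>.intervalIntegrable _ _)
      (hcont.intervalIntegrable w2 w3) (by
        intro y hy
        have h1 : -C ≤ g y := (abs_le.1 (hC y hy)).1
        have h2 : Real.exp (α * y) ≤ Real.exp (α * w3) :=
          Real.exp_le_exp.2 (mul_le_mul_of_nonneg_left hy.2 hα0)
        have h3 := mul_le_mul_of_nonneg_right h1 (Real.exp_pos (α * y)).le
        have h4 := mul_le_mul_of_nonneg_left h2 hC0
        linarith)
    rwa [intervalIntegral.integral_const, smul_eq_mul] at this
  have e3 : Real.exp (α * w) = Real.exp (α * w3) * Real.exp (α * (w - w3)) := by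
    rw [← Real.exp_add]; congr 1; ring
  have key : C * (w3 - w2) < (m0 * (w4 - w)) * Real.exp (α * (w - w3)) := by
    rwa [hR, div_lt_iff₀' hden] at hαR
  have := mul_lt_mul_of_pos_left key (Real.exp_pos (α * w3))
  rw [e3] at i2
  nlinarith

theorem tc_cut (g : ℝ → ℝ) (hg : Continuous g) (w1 w2 w3 w4 : ℝ)
    (h12 : w1 < w2) (h23 : w2 ≤ w3) (h34 : w3 < w4)
    (hneg : ∀ y, y ≤ w2 → 0 ≤ g y) (hpos : ∀ y, w3 ≤ y → 0 ≤ g y)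
    (hyp : ∀ α : ℝ, ∃ a b, a ≤ w1 ∧ w4 ≤ b ∧ (∀ y ∈ Set.Icc a w2, 0 < g y) ∧
      (∀ y ∈ Set.Icc w3 b, 0 < g y) ∧ 0 < ∫ y in a..b, g y * Real.exp (α * y)) :
    ∃ a b, a ≤ w1 ∧ w4 ≤ b ∧ (∀ y ∈ Set.Icc a w2, 0 < g y) ∧
      (∀ y ∈ Set.Icc w3 b, 0 < g y) ∧ ∀ α : ℝ, 0 < ∫ y in a..b, g y * Real.exp (α * y) := by
  obtain ⟨a0, b0, ha0, hb0, hga0, hgb0, -⟩ := hyp 0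
  have hcont : ∀ α : ℝ, Continuous fun y => g y * Real.exp (α * y) := fun α => by fun_prop
  obtain ⟨A1, hA1⟩ := tc_large g hg w2 w3 w4 h34 h23
    (fun y hy => hgb0 y ⟨hy.1, hy.2.trans hb0⟩)
  obtain ⟨A2, hA2⟩ := tc_large (fun y => g (-y)) (by fun_prop) (-w3) (-w2) (-w1) (by linarith)
    (by linarith) (fun y hy => hga0 (-y) ⟨by linarith [hy.2], by linarith [hy.1]⟩)
  have hA2' : ∀ α, α ≤ -A2 → 0 < ∫ y in w1..w3, g y * Real.exp (α * y) := by
    intro α hα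
    have := hA2 (-α) (by linarith)
    have e := intervalIntegral.integral_comp_neg (a := -w3) (b := -w1)
      (fun y => g y * Real.exp (α * y))
    simp only [neg_neg] at e
    rw [← e]
    refine this.trans_eq ?_
    congr 1
    ext y
    congr 2
    ring
  choose a b ha hb hga hgb hIntg using hyp
  obtain ⟨s, hs, hcov⟩ := (isCompact_Icc (a := -A2) (b := A1)).elim_nhds_subcover
    (fun β => {α : ℝ | 0 < ∫ y in (a β)..(b β), g y * Real.exp (α * y)})
    (fun β _ => (isOpen_lt continuous_const (tc_integral_cont g hg _ _)).mem_nhds (hIntg β))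
  have hne : (insert 0 s : Finset ℝ).Nonempty := ⟨0, Finset.mem_insert_self _ _⟩
  obtain ⟨β1, hβ1, hmin⟩ := Finset.exists_min_image (insert 0 s) a hne
  obtain ⟨β2, hβ2, hmax⟩ := Finset.exists_max_image (insert 0 s) b hne
  refine ⟨a β1, b β2, ha β1, hb β2, hga β1, hgb β2, fun α => ?_⟩
  have mono : ∀ a' b', a β1 ≤ a' → a' ≤ w2 → w3 ≤ b' → b' ≤ b β2 →
      0 < ∫ y in a'..b', g y * Real.exp (α * y) →
      0 < ∫ y in (a β1)..(b β2), g y * Real.exp (α * y) := by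
    intro a' b' h1 h2 h3 h4 h5
    refine h5.trans_le (tc_integral_mono_interval _ (hcont α) _ _ _ _ h1 h4 ?_ ?_)
    · intro y hy
      exact mul_nonneg (hneg y (hy.2.trans h2)) (Real.exp_pos _).le
    · intro y hy
      exact mul_nonneg (hpos y (h3.trans hy.1)) (Real.exp_pos _).le
  by_cases h1 : A1 ≤ α
  · exact mono w2 w4 (by linarith [ha β1]) le_rfl h34.le (hb β2) (hA1 α h1)
  by_cases h2 : α ≤ -A2
  · exact mono w1 w3 (ha β1) h12.le le_rfl (by linarith [hb β2]) (hA2' α h2)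
  have hm := hcov ⟨(not_le.1 h2).le, (not_le.1 h1).le⟩
  simp only [Set.mem_iUnion] at hm
  obtain ⟨β, hβ, hm⟩ := hm
  exact mono (a β) (b β) (hmin β (Finset.mem_insert_of_mem hβ)) (by linarith [ha β])
    (by linarith [hb β]) (hmax β (Finset.mem_insert_of_mem hβ)) hm

/-- Combination of the previous lemmas. -/
theorem tc_catalyst2 (g : ℝ → ℝ) (hg : Continuous g) (w1 w2 w3 w4 : ℝ)
    (h12 : w1 < w2) (h23 : w2 ≤ w3) (h34 : w3 < w4)
    (hneg : ∀ y, y ≤ w2 → 0 ≤ g y) (hpos : ∀ y, w3 ≤ y → 0 ≤ g y)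
    (hyp : ∀ α : ℝ, ∃ a b, a ≤ w1 ∧ w4 ≤ b ∧ (∀ y ∈ Set.Icc a w2, 0 < g y) ∧
      (∀ y ∈ Set.Icc w3 b, 0 < g y) ∧ 0 < ∫ y in a..b, g y * Real.exp (α * y)) :
    ∃ (N : ℕ) (ε : ℝ), ∀ x,
      0 ≤ ∑ k ∈ Finset.range (N + 1), (N.choose k : ℝ) * g (x - k * ε) := by
  obtain ⟨a, b, ha, hb, hga, hgb, hI⟩ := tc_cut g hg w1 w2 w3 w4 h12 h23 h34 hneg hpos hyp
  have e1 : min (w2 - w1) (w4 - w3) ≤ w2 - w1 := min_le_left _ _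
  have e2 : min (w2 - w1) (w4 - w3) ≤ w4 - w3 := min_le_right _ _
  refine tc_catalyst g hg a b (min (w2 - w1) (w4 - w3)) (by linarith)
    (lt_min (by linarith) (by linarith)) (by linarith)
    (fun y hy => hneg y (by linarith)) (fun y hy => hpos y (by linarith))
    (fun y hy => hga y ⟨hy.1, by linarith [hy.2]⟩)
    (fun y hy => hgb y ⟨by linarith [hy.1], hy.2⟩) hI

noncomputable def tcPhi (s y : ℝ) : ℝ := max (s * Real.exp (-y) - 1) 0

noncomputable def tcG {m : ℕ} (p q : Fin m → ℝ) (y : ℝ) : ℝ :=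
  ∑ i, tcPhi (p i) y - ∑ i, tcPhi (q i) y

open Classical in
noncomputable def tcJ (α v : ℝ) : ℝ :=
  if α = 1 then v * Real.log v else if α = 0 then -Real.log v else v ^ α / (α * (α - 1))

open Classical in
/-- number of zero entries -/
noncomputable def tcZ {m : ℕ} (p : Fin m → ℝ) : ℝ := ∑ i, if p i = 0 then 1 else 0

noncomputable def tcD {m : ℕ} (α : ℝ) (p q : Fin m → ℝ) : ℝ :=
  ∑ i, tcJ α (p i) - ∑ i, tcJ α (q i)

theorem tcPhi_cont (s : ℝ) : Continuous (tcPhi s) := by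
  unfold tcPhi; fun_prop

theorem tcG_cont {m : ℕ} (p q : Fin m → ℝ) : Continuous (tcG p q) := by
  unfold tcG tcPhi; fun_prop

theorem tcPhi_of_le {s y : ℝ} (h : s ≤ Real.exp y) : tcPhi s y = 0 := by
  unfold tcPhi
  apply max_eq_right
  rw [Real.exp_neg, ← div_eq_mul_inv, sub_nonpos, div_le_one (Real.exp_pos _)]
  exact h

theorem tcPhi_of_ge {s y : ℝ} (h : Real.exp y ≤ s) : tcPhi s y = s * Real.exp (-y) - 1 := by
  unfold tcPhi
  apply max_eq_left
  rw [Real.exp_neg, ← div_eq_mul_inv, sub_nonneg, one_le_div (Real.exp_pos _)]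
  exact h

theorem tc_int_exp (β a z : ℝ) (hβ : β ≠ 0) :
    ∫ y in a..z, Real.exp (β * y) = (Real.exp (β * z) - Real.exp (β * a)) / β := by
  rw [intervalIntegral.integral_comp_mul_left (fun y => Real.exp y) hβ, integral_exp, smul_eq_mul]
  field_simp

open Classical in
theorem tc_int_phi (α a : ℝ) : ∃ c1 c0 : ℝ, (0 < α → c0 = Real.exp (α * a) / α) ∧
    ∀ v b, 0 < v → a ≤ Real.log v → Real.log v ≤ b →
      ∫ y in a..b, tcPhi v y * Real.exp (α * y) = tcJ α v - v * c1 + c0 := by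
  have main : ∀ v b, 0 < v → a ≤ Real.log v → Real.log v ≤ b →
      ∫ y in a..b, tcPhi v y * Real.exp (α * y) =
        v * (∫ y in a..Real.log v, Real.exp ((α - 1) * y)) -
          ∫ y in a..Real.log v, Real.exp (α * y) := by
    intro v b hv ha hb
    have hc : Continuous fun y => tcPhi v y * Real.exp (α * y) :=
      (tcPhi_cont v).mul (by fun_prop)
    rw [← intervalIntegral.integral_add_adjacent_intervals (μ := MeasureTheory.volume)
      (hc.intervalIntegrable a (Real.log v)) (hc.intervalIntegrable (Real.log v) b)]
    have e2 : ∫ y in (Real.log v)..b, tcPhi v y * Real.exp (α * y) = 0 := by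
      rw [intervalIntegral.integral_congr (g := fun _ => (0 : ℝ))]
      · simp
      · intro y hy
        rw [Set.uIcc_of_le hb] at hy
        simp only
        rw [tcPhi_of_le, zero_mul]
        rw [← Real.exp_log hv]
        exact Real.exp_le_exp.2 hy.1
    have e1 : ∫ y in a..(Real.log v), tcPhi v y * Real.exp (α * y) =
        ∫ y in a..(Real.log v), (v * Real.exp ((α - 1) * y) - Real.exp (α * y)) := by
      apply intervalIntegral.integral_congr
      intro y hy
      rw [Set.uIcc_of_le ha] at hy
      simp only
      rw [tcPhi_of_ge]
      · have : Real.exp ((α - 1) * y) = Real.exp (-y) * Real.exp (α * y) := by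
          rw [← Real.exp_add]; congr 1; ring
        rw [this]; ring
      · rw [← Real.exp_log hv]
        exact Real.exp_le_exp.2 hy.2
    rw [e1, e2, add_zero, intervalIntegral.integral_sub, intervalIntegral.integral_const_mul]
    · exact Continuous.intervalIntegrable (by fun_prop) _ _
    · exact Continuous.intervalIntegrable (by fun_prop) _ _
  by_cases h1 : α = 1
  · refine ⟨1 + a, Real.exp a, fun _ => by rw [h1]; simp, fun v b hv ha hb => ?_⟩
    rw [main v b hv ha hb, tcJ, if_pos h1, h1, tc_int_exp 1 _ _ one_ne_zero]
    simp [Real.exp_log hv]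
    ring
  by_cases h0 : α = 0
  · refine ⟨-Real.exp (-a), -1 + a, fun h => absurd h (by rw [h0]; simp), fun v b hv ha hb => ?_⟩
    rw [main v b hv ha hb, tcJ, if_neg h1, if_pos h0, h0, tc_int_exp _ _ _ (by norm_num)]
    simp [Real.exp_neg, Real.exp_log hv]
    field_simp
    ring
  · refine ⟨Real.exp ((α - 1) * a) / (α - 1), Real.exp (α * a) / α, fun _ => rfl,
      fun v b hv ha hb => ?_⟩
    have h1' : α - 1 ≠ 0 := sub_ne_zero.2 h1
    rw [main v b hv ha hb, tcJ, if_neg h1, if_neg h0, tc_int_exp _ _ _ h0, tc_int_exp _ _ _ h1']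
    have e1 : Real.exp (α * Real.log v) = v ^ α := by
      rw [Real.rpow_def_of_pos hv, mul_comm]
    have e2 : v * Real.exp ((α - 1) * Real.log v) = v ^ α := by
      rw [← e1]
      nth_rewrite 1 [← Real.exp_log hv]
      rw [← Real.exp_add]; congr 1; ring
    rw [mul_div_assoc', mul_sub, e2, e1]
    field_simp
    ring

theorem tcJ_zero (α : ℝ) (hα : 0 < α) : tcJ α 0 = 0 := by
  unfold tcJ
  split_ifs
  · simp
  · simp
  · rw [Real.zero_rpow hα.ne']; simp

theorem tc_int_sum {m : ℕ} (p : Fin m → ℝ) (α a b c1 c0 : ℝ)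
    (hp : ∀ i, 0 ≤ p i) (hsum : ∑ i, p i = 1) (hα : 0 < α ∨ ∀ i, p i ≠ 0)
    (hc : ∀ v b, 0 < v → a ≤ Real.log v → Real.log v ≤ b →
      ∫ y in a..b, tcPhi v y * Real.exp (α * y) = tcJ α v - v * c1 + c0)
    (ha : ∀ i, 0 < p i → a ≤ Real.log (p i)) (hb : ∀ i, 0 < p i → Real.log (p i) ≤ b) :
    ∫ y in a..b, (∑ i, tcPhi (p i) y) * Real.exp (α * y) =
      ∑ i, tcJ α (p i) - c1 + c0 * m - c0 * tcZ p := by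
  classical
  simp_rw [Finset.sum_mul]
  rw [intervalIntegral.integral_finsetSum]
  · have : ∀ i, ∫ y in a..b, tcPhi (p i) y * Real.exp (α * y) =
        tcJ α (p i) - p i * c1 + c0 - c0 * (if p i = 0 then 1 else 0) := by
      intro i
      rcases (hp i).eq_or_lt with h | h
      · rw [if_pos h.symm, ← h]
        have hα' : 0 < α := hα.resolve_right fun h' => h' i h.symm
        rw [tcJ_zero α hα']
        have : ∀ y, tcPhi 0 y = 0 := fun y => tcPhi_of_le (Real.exp_pos y).le
        simp [this]
      · rw [if_neg h.ne', hc _ _ h (ha i h) (hb i h)]; ring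
    simp_rw [this]
    rw [Finset.sum_sub_distrib, Finset.sum_add_distrib, Finset.sum_sub_distrib,
      ← Finset.sum_mul, hsum, ← Finset.mul_sum, tcZ]
    simp
    ring
  · intro i _
    exact ((tcPhi_cont _).mul (by fun_prop)).intervalIntegrable _ _

theorem tc_int_G {m : ℕ} (p q : Fin m → ℝ) (hp : IsProbDist p) (hq : IsProbDist q) (α a b : ℝ)
    (hα : 0 < α ∨ ((∀ i, p i ≠ 0) ∧ ∀ i, q i ≠ 0))
    (hap : ∀ i, 0 < p i → a ≤ Real.log (p i)) (hbp : ∀ i, 0 < p i → Real.log (p i) ≤ b)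
    (haq : ∀ i, 0 < q i → a ≤ Real.log (q i)) (hbq : ∀ i, 0 < q i → Real.log (q i) ≤ b) :
    ∃ c0 : ℝ, (0 < α → c0 = Real.exp (α * a) / α) ∧
      ∫ y in a..b, tcG p q y * Real.exp (α * y) = tcD α p q - c0 * (tcZ p - tcZ q) := by
  obtain ⟨c1, c0, h0, hc⟩ := tc_int_phi α a
  refine ⟨c0, h0, ?_⟩
  have e1 := tc_int_sum p α a b c1 c0 hp.1 hp.2 (hα.imp id And.left) hc hap hbp
  have e2 := tc_int_sum q α a b c1 c0 hq.1 hq.2 (hα.imp id And.right) hc haq hbq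
  unfold tcG tcD
  simp_rw [sub_mul]
  rw [intervalIntegral.integral_sub, e1, e2]
  · ring
  · apply Continuous.intervalIntegrable
    unfold tcPhi; fun_prop
  · apply Continuous.intervalIntegrable
    unfold tcPhi; fun_prop

theorem tcZ_zero {m : ℕ} (p : Fin m → ℝ) (h : ∀ i, p i ≠ 0) : tcZ p = 0 := by
  classical
  unfold tcZ
  exact Finset.sum_eq_zero fun i _ => if_neg (h i)

theorem tcZ_nonneg {m : ℕ} (p : Fin m → ℝ) : 0 ≤ tcZ p := by
  classical
  unfold tcZ
  exact Finset.sum_nonneg fun i _ => by split_ifs <;> norm_num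

theorem tcZ_pos {m : ℕ} (p : Fin m → ℝ) (i : Fin m) (h : p i = 0) : 0 < tcZ p := by
  classical
  unfold tcZ
  exact Finset.sum_pos' (fun i _ => by split_ifs <;> norm_num) ⟨i, Finset.mem_univ _, by simp [h]⟩

/-- bounds for the logarithms of the entries -/
theorem tc_log_bounds {m : ℕ} (p : Fin m → ℝ) :
    ∃ B : ℝ, 0 ≤ B ∧ ∀ i, |Real.log (p i)| ≤ B :=
  ⟨∑ i, |Real.log (p i)|, Finset.sum_nonneg fun _ _ => abs_nonneg _, fun i =>
    Finset.single_le_sum (f := fun i => |Real.log (p i)|) (fun _ _ => abs_nonneg _)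
      (Finset.mem_univ i)⟩

open Classical in
noncomputable def tcN {m : ℕ} (p q : Fin m → ℝ) (v : ℝ) : ℝ :=
  ((Finset.univ.filter fun i => p i = v).card : ℝ) - (Finset.univ.filter fun i => q i = v).card

open Classical in
noncomputable def tcV {m : ℕ} (p q : Fin m → ℝ) : Finset ℝ :=
  (Finset.univ.image p ∪ Finset.univ.image q).filter fun v => tcN p q v ≠ 0

theorem tc_sum_V {m : ℕ} (p q : Fin m → ℝ) (f : ℝ → ℝ) :
    ∑ i, f (p i) - ∑ i, f (q i) = ∑ v ∈ tcV p q, tcN p q v * f v := by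
  classical
  have aux : ∀ r : Fin m → ℝ, ∀ W : Finset ℝ, Finset.univ.image r ⊆ W →
      ∑ i, f (r i) = ∑ v ∈ W, ((Finset.univ.filter fun i => r i = v).card : ℝ) * f v := by
    intro r W hW
    rw [Finset.sum_comp f r]
    simp_rw [nsmul_eq_mul]
    refine Finset.sum_subset hW fun v _ hv => ?_
    have : (Finset.univ.filter fun i => r i = v) = ∅ := by
      ext i
      simp only [Finset.mem_filter, Finset.mem_univ, true_and, Finset.notMem_empty, iff_false]
      intro h
      exact hv (Finset.mem_image.2 ⟨i, Finset.mem_univ _, h⟩)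
    rw [this]; simp
  rw [aux p _ Finset.subset_union_left, aux q _ Finset.subset_union_right,
    ← Finset.sum_sub_distrib, tcV, Finset.sum_filter]
  refine Finset.sum_congr rfl fun v _ => ?_
  split_ifs with h
  · rw [tcN]; ring
  · rw [not_not, tcN] at h
    rw [← sub_mul, h, zero_mul]

theorem tc_V_nonempty {m : ℕ} (p q : Fin m → ℝ)
    (hne : ¬ ∃ σ : Equiv.Perm (Fin m), p = q ∘ σ) : (tcV p q).Nonempty := by
  classical
  by_contra hV
  rw [Finset.not_nonempty_iff_eq_empty] at hV
  apply hne
  have hcard : ∀ v, Fintype.card {i // p i = v} = Fintype.card {i // q i = v} := by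
    intro v
    rw [Fintype.card_subtype, Fintype.card_subtype]
    by_cases hv : v ∈ Finset.univ.image p ∪ Finset.univ.image q
    · have : v ∉ tcV p q := by rw [hV]; simp
      rw [tcV, Finset.mem_filter, not_and, not_not] at this
      have := this hv
      rw [tcN, sub_eq_zero] at this
      exact_mod_cast this
    · simp only [Finset.mem_union, Finset.mem_image, Finset.mem_univ, true_and, not_or,
        not_exists] at hv
      rw [Finset.filter_false_of_mem (fun i _ => hv.1 i),
        Finset.filter_false_of_mem (fun i _ => hv.2 i)]
  let e : ∀ v, {i // p i = v} ≃ {i // q i = v} := fun v => Fintype.equivOfCardEq (hcard v)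
  refine ⟨((Equiv.sigmaFiberEquiv p).symm.trans (Equiv.sigmaCongrRight e)).trans
    (Equiv.sigmaFiberEquiv q), ?_⟩
  funext i
  have := (e (p i) ⟨i, rfl⟩).2
  simp [Equiv.sigmaFiberEquiv]
  exact this.symm

theorem tc_gap (V : Finset ℝ) (vp : ℝ) (hmax : ∀ v ∈ V, v ≤ vp) (L : ℝ) (hL : L < vp) :
    ∃ t, L < t ∧ t < vp ∧ ∀ v ∈ V, v ≠ vp → v ≤ t := by
  classical
  obtain ⟨c, hc1, hc2⟩ := exists_between hL
  have hne : (insert c (V.erase vp)).Nonempty := ⟨c, Finset.mem_insert_self _ _⟩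
  obtain ⟨t, ht, hm⟩ := Finset.exists_max_image _ id hne
  refine ⟨t, hc1.trans_le (hm c (Finset.mem_insert_self _ _)), ?_, fun v hv hvp =>
    hm v (Finset.mem_insert_of_mem (Finset.mem_erase.2 ⟨hvp, hv⟩))⟩
  rcases Finset.mem_insert.1 ht with h | h
  · rw [h]; exact hc2
  · exact lt_of_le_of_ne (hmax t (Finset.mem_of_mem_erase h)) (Finset.ne_of_mem_erase h)

theorem tc_gap' (V : Finset ℝ) (vm : ℝ) (hmin : ∀ v ∈ V, vm ≤ v) :
    ∃ t, vm < t ∧ ∀ v ∈ V, v ≠ vm → t ≤ v := by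
  classical
  obtain ⟨t, _, h2, h3⟩ := tc_gap (V.image fun x => -x) (-vm) (by
    intro v hv
    obtain ⟨w, hw, rfl⟩ := Finset.mem_image.1 hv
    linarith [hmin w hw]) (-vm - 1) (by linarith)
  refine ⟨-t, by linarith, fun v hv hne => ?_⟩
  have := h3 (-v) (Finset.mem_image_of_mem _ hv) (by intro h; apply hne; linarith)
  linarith

/-- structure of `tcG` near the two ends of its support -/
theorem tc_windows {m : ℕ} (p q : Fin m → ℝ) (hp : IsProbDist p) (hq : IsProbDist q)
    (hne : ¬ ∃ σ : Equiv.Perm (Fin m), p = q ∘ σ) :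
    ∃ vm vp tm tp : ℝ, vm ∈ tcV p q ∧ vp ∈ tcV p q ∧ (∀ v ∈ tcV p q, vm ≤ v ∧ v ≤ vp) ∧
      0 ≤ vm ∧ vm < vp ∧ vm < tm ∧ 0 < tp ∧ tp < vp ∧ tcN p q vm ≠ 0 ∧ tcN p q vp ≠ 0 ∧
      (∀ v ∈ tcV p q, v ≠ vp → v ≤ tp) ∧ (∀ v ∈ tcV p q, v ≠ vm → tm ≤ v) ∧
      (∀ y, tp ≤ Real.exp y → tcG p q y = tcN p q vp * max (vp * Real.exp (-y) - 1) 0) ∧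
      (∀ y, Real.exp y ≤ tm → tcG p q y = tcN p q vm * max (1 - vm * Real.exp (-y)) 0) := by
  classical
  have hV := tc_V_nonempty p q hne
  obtain ⟨vm, hvm, hmin⟩ := Finset.exists_min_image (tcV p q) id hV
  obtain ⟨vp, hvp, hmax⟩ := Finset.exists_max_image (tcV p q) id hV
  simp only [id] at hmin hmax
  have hn : ∀ v ∈ tcV p q, tcN p q v ≠ 0 := fun v hv => (Finset.mem_filter.1 hv).2
  have hnn : ∀ v ∈ tcV p q, 0 ≤ v := by
    intro v hv
    have := (Finset.mem_filter.1 hv).1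
    simp only [Finset.mem_union, Finset.mem_image, Finset.mem_univ, true_and] at this
    rcases this with ⟨i, rfl⟩ | ⟨i, rfl⟩
    · exact hp.1 i
    · exact hq.1 i
  have s0 : ∑ v ∈ tcV p q, tcN p q v = 0 := by
    have := tc_sum_V p q (fun _ => 1)
    simpa using this.symm
  have s1 : ∑ v ∈ tcV p q, tcN p q v * v = 0 := by
    have := tc_sum_V p q (fun v => v)
    rw [← this, hp.2, hq.2, sub_self]
  have hlt : vm < vp := by
    by_contra h
    have hall : tcV p q = {vp} := by
      ext v
      rw [Finset.mem_singleton]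
      constructor
      · intro hv; exact le_antisymm (hmax v hv) ((not_lt.1 h).trans (hmin v hv))
      · rintro rfl; exact hvp
    rw [hall, Finset.sum_singleton] at s0
    exact hn vp hvp s0
  obtain ⟨tp, htp0, htp, htp'⟩ := tc_gap (tcV p q) vp hmax 0 ((hnn vm hvm).trans_lt hlt)
  obtain ⟨tm, htm, htm'⟩ := tc_gap' (tcV p q) vm hmin
  have hG : ∀ y, tcG p q y = ∑ v ∈ tcV p q, tcN p q v * tcPhi v y :=
    fun y => tc_sum_V p q (fun v => tcPhi v y)
  refine ⟨vm, vp, tm, tp, hvm, hvp, fun v hv => ⟨hmin v hv, hmax v hv⟩, hnn vm hvm, hlt, htm,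
    htp0, htp, hn _ hvm, hn _ hvp, htp', htm', ?_, ?_⟩
  · intro y hy
    rw [hG, Finset.sum_eq_single_of_mem vp hvp]
    · rfl
    · intro v hv hne
      rw [tcPhi_of_le ((htp' v hv hne).trans hy), mul_zero]
  · intro y hy
    have e : tcG p q y = ∑ v ∈ tcV p q, tcN p q v * max (1 - v * Real.exp (-y)) 0 := by
      have e1 : ∀ v, tcPhi v y = max (1 - v * Real.exp (-y)) 0 + (v * Real.exp (-y) - 1) := by
        intro v
        unfold tcPhi
        rcases le_total (v * Real.exp (-y)) 1 with h | h
        · rw [max_eq_right (by linarith), max_eq_left (by linarith)]; ring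
        · rw [max_eq_left (by linarith), max_eq_right (by linarith)]; ring
      rw [hG]
      simp_rw [e1, mul_add]
      rw [Finset.sum_add_distrib]
      have : ∑ v ∈ tcV p q, tcN p q v * (v * Real.exp (-y) - 1) =
          (∑ v ∈ tcV p q, tcN p q v * v) * Real.exp (-y) - ∑ v ∈ tcV p q, tcN p q v := by
        rw [Finset.sum_mul, ← Finset.sum_sub_distrib]
        exact Finset.sum_congr rfl fun v _ => by ring
      rw [this, s0, s1]; ring
    rw [e, Finset.sum_eq_single_of_mem vm hvm]
    intro v hv hne
    have h1 := hy.trans (htm' v hv hne)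
    rw [max_eq_right, mul_zero]
    rw [Real.exp_neg, ← div_eq_mul_inv, sub_nonpos, one_le_div (Real.exp_pos _)]
    exact h1

open Classical in
theorem tc_kron_pot {m : ℕ} {κ : Type*} [Fintype κ] (p : Fin m → ℝ) (r : κ → ℝ)
    (hr : ∀ k, 0 ≤ r k) (t : ℝ) (ht : 0 < t) :
    ∑ z, max (kron p r z - t) 0 =
      t * ∑ k, if 0 < r k then ∑ i, tcPhi (p i) (Real.log t - Real.log (r k)) else 0 := by
  rw [Fintype.sum_prod_type, Finset.sum_comm, Finset.mul_sum]
  refine Finset.sum_congr rfl fun k _ => ?_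
  split_ifs with h
  · rw [Finset.mul_sum]
    refine Finset.sum_congr rfl fun i _ => ?_
    unfold kron tcPhi
    rw [neg_sub, Real.exp_sub, Real.exp_log h, Real.exp_log ht,
      mul_max_of_nonneg _ _ ht.le, mul_zero]
    congr 1
    field_simp
  · have h0 : r k = 0 := le_antisymm (not_lt.1 h) (hr k)
    rw [mul_zero]
    refine Finset.sum_eq_zero fun i _ => ?_
    unfold kron
    simp only [h0, mul_zero, zero_sub]
    exact max_eq_right (by linarith)

open Classical in
theorem tc_kron_pot_sub {m : ℕ} {κ : Type*} [Fintype κ] (p q : Fin m → ℝ) (r : κ → ℝ)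
    (hr : ∀ k, 0 ≤ r k) (t : ℝ) (ht : 0 < t) :
    ∑ z, max (kron p r z - t) 0 - ∑ z, max (kron q r z - t) 0 =
      t * ∑ k, if 0 < r k then tcG p q (Real.log t - Real.log (r k)) else 0 := by
  rw [tc_kron_pot p r hr t ht, tc_kron_pot q r hr t ht, ← mul_sub, ← Finset.sum_sub_distrib]
  congr 1
  refine Finset.sum_congr rfl fun k _ => ?_
  split_ifs
  · rfl
  · ring

theorem tc_kron_sum {m : ℕ} {κ : Type*} [Fintype κ] (p : Fin m → ℝ) (r : κ → ℝ) :
    ∑ z, kron p r z = (∑ i, p i) * ∑ k, r k := by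
  rw [Fintype.sum_prod_type, Finset.sum_mul_sum]
  rfl

theorem tc_trumps_of_catalyst {m : ℕ} (p q : Fin m → ℝ) (hp : IsProbDist p) (hq : IsProbDist q)
    (N : ℕ) (ε : ℝ)
    (h : ∀ x, 0 ≤ ∑ k ∈ Finset.range (N + 1), (N.choose k : ℝ) * tcG p q (x - k * ε)) :
    Trumps p q := by
  classical
  set Z : ℝ := ∑ S : Finset (Fin N), Real.exp (S.card * ε) with hZ
  have hZ0 : 0 < Z := Finset.sum_pos (fun S _ => Real.exp_pos _) ⟨∅, Finset.mem_univ _⟩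
  let e := Fintype.equivFin (Finset (Fin N))
  let r0 : Finset (Fin N) → ℝ := fun S => Real.exp (S.card * ε) / Z
  have hr0 : ∀ S, 0 < r0 S := fun S => div_pos (Real.exp_pos _) hZ0
  let r : Fin (Fintype.card (Finset (Fin N))) → ℝ := fun k => r0 (e.symm k)
  have hr : ∀ k, 0 < r k := fun k => hr0 _
  have hrs : ∑ k, r k = 1 := by
    have : ∑ k, r k = ∑ S, r0 S := e.symm.sum_comp r0
    rw [this]
    simp only [r0]
    rw [← Finset.sum_div, ← hZ, div_self hZ0.ne']
  refine ⟨_, r, ⟨fun k => (hr k).le, hrs⟩, tc_maj_of_pot _ _ (fun z =>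
    mul_nonneg (hp.1 _) (hr _).le) fun t ht => ?_⟩
  rcases ht.eq_or_lt with h0 | h0
  · have aux : ∀ s : Fin m → ℝ, IsProbDist s → ∑ z, max (kron s r z - t) 0 = 1 := by
      intro s hs
      have : ∀ z, max (kron s r z - t) 0 = kron s r z := by
        intro z
        rw [← h0, sub_zero]
        exact max_eq_left (mul_nonneg (hs.1 _) (hr _).le)
      simp_rw [this]
      rw [tc_kron_sum, hs.2, hrs, one_mul]
    rw [aux p hp, aux q hq]
  · have e1 := tc_kron_pot_sub p q r (fun k => (hr k).le) t h0
    have e2 : ∑ k, (if 0 < r k then tcG p q (Real.log t - Real.log (r k)) else 0) =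
        ∑ k ∈ Finset.range (N + 1),
          (N.choose k : ℝ) * tcG p q ((Real.log t + Real.log Z) - k * ε) := by
      have e3 : ∀ k, (if 0 < r k then tcG p q (Real.log t - Real.log (r k)) else 0) =
          (fun S : Finset (Fin N) => tcG p q ((Real.log t + Real.log Z) - S.card * ε))
            (e.symm k) := by
        intro k
        rw [if_pos (hr k)]
        simp only [r, r0]
        rw [Real.log_div (Real.exp_pos _).ne' hZ0.ne', Real.log_exp]
        congr 1; ring
      rw [Finset.sum_congr rfl fun k _ => e3 k,
        e.symm.sum_comp (fun S : Finset (Fin N) =>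
          tcG p q ((Real.log t + Real.log Z) - S.card * ε))]
      have e4 := Finset.sum_powerset_apply_card
        (fun k : ℕ => tcG p q ((Real.log t + Real.log Z) - k * ε))
        (x := (Finset.univ : Finset (Fin N)))
      rw [Finset.powerset_univ, Finset.card_univ, Fintype.card_fin] at e4
      rw [e4]
      simp_rw [nsmul_eq_mul]
    rw [e2] at e1
    have := mul_nonneg h0.le (h (Real.log t + Real.log Z))
    linarith

theorem tc_pow_sum_pos {m : ℕ} (p : Fin m → ℝ) (hp : IsProbDist p) (α : ℝ) :
    0 < ∑ i, p i ^ α := by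
  have : ∃ i, 0 < p i := by
    by_contra h
    push Not at h
    have := Finset.sum_nonpos fun i (_ : i ∈ Finset.univ) => h i
    rw [hp.2] at this
    linarith
  obtain ⟨i, hi⟩ := this
  exact Finset.sum_pos' (fun i _ => Real.rpow_nonneg (hp.1 i) _)
    ⟨i, Finset.mem_univ _, Real.rpow_pos_of_pos hi _⟩

theorem tcD_gen {m : ℕ} (p q : Fin m → ℝ) (α : ℝ) (h0 : α ≠ 0) (h1 : α ≠ 1) :
    tcD α p q = (∑ i, p i ^ α - ∑ i, q i ^ α) / (α * (α - 1)) := by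
  unfold tcD tcJ
  simp only [h0, h1, if_false]
  rw [← Finset.sum_div, ← Finset.sum_div, sub_div]

theorem tc_renyi_iff {m : ℕ} (p q : Fin m → ℝ) (hp : IsProbDist p) (hq : IsProbDist q)
    (α : ℝ) (h0 : α ≠ 0) : renyi α p < renyi α q ↔ 0 < tcD α p q := by
  unfold renyi
  by_cases h1 : α = 1
  · simp only [h1, if_true, tcD, tcJ, shannonEntropy]
    constructor <;> intro h <;> linarith
  rw [if_neg h1, if_neg h1, tcD_gen p q α h0 h1]
  have hP := tc_pow_sum_pos p hp α
  have hQ := tc_pow_sum_pos q hq α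
  rcases lt_or_gt_of_ne h0 with h | h
  · rw [Real.sign_of_neg h]
    have hc : (-1 : ℝ) / (1 - α) < 0 := div_neg_of_neg_of_pos (by norm_num) (by linarith)
    rw [mul_lt_mul_left_of_neg hc, Real.log_lt_log_iff hQ hP,
      div_pos_iff_of_pos_right (mul_pos_of_neg_of_neg h (by linarith)), sub_pos]
  · rw [Real.sign_of_pos h]
    rcases lt_or_gt_of_ne h1 with h' | h'
    · have hc : (0 : ℝ) < 1 / (1 - α) := div_pos one_pos (by linarith)
      have hd : α * (α - 1) < 0 := mul_neg_of_pos_of_neg h (by linarith)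
      rw [mul_lt_mul_iff_right₀ hc, Real.log_lt_log_iff hP hQ]
      constructor
      · intro hlt; exact div_pos_of_neg_of_neg (by linarith) hd
      · intro hlt
        rcases div_pos_iff.1 hlt with ⟨_, h3⟩ | ⟨h3, _⟩
        · linarith
        · linarith
    · have hc : (1 : ℝ) / (1 - α) < 0 := div_neg_of_pos_of_neg one_pos (by linarith)
      rw [mul_lt_mul_left_of_neg hc, Real.log_lt_log_iff hQ hP,
        div_pos_iff_of_pos_right (mul_pos h (by linarith)), sub_pos]

theorem tc_burg_iff {m : ℕ} (p q : Fin m → ℝ) (hm : 0 < m) :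
    burg p < burg q ↔ 0 < tcD 0 p q := by
  unfold burg tcD tcJ
  simp only [Fintype.card_fin, zero_ne_one, if_false, if_true]
  rw [mul_lt_mul_iff_right₀ (by positivity)]
  simp only [Finset.sum_neg_distrib]
  constructor <;> intro h <;> linarith

/-- forward direction, analytic part -/
theorem tc_forward {m : ℕ} (p q : Fin m → ℝ) (hp : IsProbDist p) (hq : IsProbDist q)
    (hne : ¬ ∃ σ : Equiv.Perm (Fin m), p = q ∘ σ) (h : Trumps p q) :
    tcZ q ≤ tcZ p ∧ ∀ α : ℝ, (0 < α ∨ ((∀ i, p i ≠ 0) ∧ ∀ i, q i ≠ 0)) → 0 < tcD α p q := by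
  classical
  obtain ⟨n, r, hr, hmaj⟩ := h
  have hpos : ∀ x, 0 ≤ ∑ k, if 0 < r k then tcG p q (x - Real.log (r k)) else 0 := by
    intro x
    have h1 := tc_pot_of_maj _ _ hmaj (Real.exp x) (Real.exp_pos x).le
    have h2 := tc_kron_pot_sub p q r hr.1 (Real.exp x) (Real.exp_pos x)
    rw [Real.log_exp] at h2
    have h3 : 0 ≤ Real.exp x * ∑ k, if 0 < r k then tcG p q (x - Real.log (r k)) else 0 := by
      rw [← h2]; linarith
    exact nonneg_of_mul_nonneg_right h3 (Real.exp_pos x)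
  set S := Finset.univ.filter fun k => 0 < r k with hS
  have hpos' : ∀ x, 0 ≤ ∑ k ∈ S, tcG p q (x - Real.log (r k)) := by
    intro x; rw [hS, Finset.sum_filter]; exact hpos x
  have hSmem : ∀ k ∈ S, 0 < r k := fun k hk => (Finset.mem_filter.1 hk).2
  have hSne : S.Nonempty := by
    by_contra hc
    rw [Finset.not_nonempty_iff_eq_empty] at hc
    have : ∀ k, r k ≤ 0 := by
      intro k
      by_contra hk
      have : k ∈ S := Finset.mem_filter.2 ⟨Finset.mem_univ _, not_le.1 hk⟩
      rw [hc] at this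
      simp at this
    have := Finset.sum_nonpos fun k (_ : k ∈ Finset.univ) => this k
    rw [hr.2] at this
    linarith
  obtain ⟨Bp, hBp0, hBp⟩ := tc_log_bounds p
  obtain ⟨Bq, hBq0, hBq⟩ := tc_log_bounds q
  obtain ⟨Br, hBr0, hBr⟩ := tc_log_bounds r
  have hGlow : ∀ y, y ≤ -(Bp + Bq) → tcG p q y = tcZ p - tcZ q := by
    have aux : ∀ s : Fin m → ℝ, IsProbDist s → ∀ y, (∀ i, y ≤ -|Real.log (s i)|) →
        ∑ i, tcPhi (s i) y = Real.exp (-y) - m + tcZ s := by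
      intro s hs y hy
      have : ∀ i, tcPhi (s i) y = s i * Real.exp (-y) - 1 + (if s i = 0 then 1 else 0) := by
        intro i
        rcases (hs.1 i).eq_or_lt with h0 | h0
        · rw [if_pos h0.symm, ← h0, tcPhi_of_le (Real.exp_pos y).le]; ring
        · rw [if_neg h0.ne', tcPhi_of_ge]
          · ring
          · rw [← Real.exp_log h0]
            apply Real.exp_le_exp.2
            have := neg_abs_le (Real.log (s i))
            linarith [hy i]
      simp_rw [this]
      rw [Finset.sum_add_distrib, Finset.sum_sub_distrib, ← Finset.sum_mul, hs.2, tcZ]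
      simp
    intro y hy
    unfold tcG
    rw [aux p hp y fun i => by linarith [hBp i], aux q hq y fun i => by linarith [hBq i]]
    ring
  have hZ : tcZ q ≤ tcZ p := by
    have h1 := hpos' (-(Bp + Bq) - Br)
    rw [Finset.sum_congr rfl (g := fun _ => tcZ p - tcZ q), Finset.sum_const, nsmul_eq_mul] at h1
    · have : (0 : ℝ) < S.card := by exact_mod_cast hSne.card_pos
      have := nonneg_of_mul_nonneg_right h1 this
      linarith
    · intro k _
      apply hGlow
      have := neg_abs_le (Real.log (r k))
      linarith [hBr k]
  refine ⟨hZ, fun α hα => ?_⟩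
  -- a point where the convolution is nonzero
  obtain ⟨vm, vp, tm, tp, hvm, hvp, hV, hvm0, hlt, htm, htp0, htp, hnm, hnp, -, -, hGp, -⟩ :=
    tc_windows p q hp hq hne
  have hvp0 : 0 < vp := hvm0.trans_lt hlt
  obtain ⟨k0, hk0, hk0max⟩ := Finset.exists_max_image S r hSne
  have hrm : 0 < r k0 := hSmem k0 hk0
  obtain ⟨tr, htr0, htr, htr'⟩ := tc_gap (S.image r) (r k0) (by
    intro v hv
    obtain ⟨k, hk, rfl⟩ := Finset.mem_image.1 hv
    exact hk0max k hk) 0 hrm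
  obtain ⟨x, hx⟩ : ∃ x, 0 < ∑ k ∈ S, tcG p q (x - Real.log (r k)) := by
    set E := max tp (vp * tr / r k0) with hE
    have hE0 : 0 < E := htp0.trans_le (le_max_left _ _)
    have hEv : E < vp := by
      apply max_lt htp
      rw [div_lt_iff₀ hrm]
      exact mul_lt_mul_of_pos_left htr hvp0
    refine ⟨Real.log E + Real.log (r k0), lt_of_le_of_ne (hpos' _) (Ne.symm ?_)⟩
    have e1 : ∀ k ∈ S, tcG p q (Real.log E + Real.log (r k0) - Real.log (r k)) =
        if r k = r k0 then tcN p q vp * (vp / E - 1) else 0 := by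
      intro k hk
      have hrk := hSmem k hk
      have e2 : Real.exp (Real.log E + Real.log (r k0) - Real.log (r k)) = E * r k0 / r k := by
        rw [Real.exp_sub, Real.exp_add, Real.exp_log hE0, Real.exp_log hrm, Real.exp_log hrk]
      have hge : tp ≤ E * r k0 / r k := by
        rw [le_div_iff₀ hrk]
        exact mul_le_mul (le_max_left _ _) (hk0max k hk) hrk.le hE0.le
      rw [hGp _ (by rw [e2]; exact hge), Real.exp_neg, e2]
      split_ifs with hkk
      · rw [hkk, mul_div_cancel_right₀ _ hrm.ne', max_eq_left, div_eq_mul_inv]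
        rw [← div_eq_mul_inv, sub_nonneg, one_le_div hE0]
        exact hEv.le
      · have h1 := htr' (r k) (Finset.mem_image_of_mem _ hk) hkk
        rw [max_eq_right, mul_zero]
        rw [← div_eq_mul_inv, sub_nonpos, div_le_one (by positivity), le_div_iff₀ hrk]
        have h2 : vp * tr / r k0 ≤ E := le_max_right _ _
        rw [div_le_iff₀ hrm] at h2
        exact (mul_le_mul_of_nonneg_left h1 hvp0.le).trans h2
    rw [Finset.sum_congr rfl e1, ← Finset.sum_filter, Finset.sum_const, nsmul_eq_mul]
    refine mul_ne_zero ?_ (mul_ne_zero hnp ?_)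
    · have : 0 < (S.filter fun k => r k = r k0).card :=
        Finset.card_pos.2 ⟨k0, Finset.mem_filter.2 ⟨hk0, rfl⟩⟩
      exact_mod_cast this.ne'
    · have : 1 < vp / E := by rwa [one_lt_div hE0]
      linarith
  -- integrate
  set M := Bp + Bq + Br + |x| + 1 with hM
  have hM0 : 0 < M := by positivity
  have hcont : Continuous (tcG p q) := tcG_cont p q
  have hIntg : 0 < ∫ z in (-M)..M, (∑ k ∈ S, tcG p q (z - Real.log (r k))) * Real.exp (α * z) := by
    apply intervalIntegral.integral_pos (by linarith)
    · apply Continuous.continuousOn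
      fun_prop
    · intro z _
      exact mul_nonneg (hpos' z) (Real.exp_pos _).le
    · refine ⟨x, ⟨?_, ?_⟩, mul_pos hx (Real.exp_pos _)⟩
      · linarith [neg_abs_le x]
      · linarith [le_abs_self x]
  simp_rw [Finset.sum_mul] at hIntg
  rw [intervalIntegral.integral_finsetSum (fun k _ => by
    apply Continuous.intervalIntegrable; fun_prop)] at hIntg
  have hterm : ∀ k ∈ S, ∫ z in (-M)..M, tcG p q (z - Real.log (r k)) * Real.exp (α * z) ≤
      Real.exp (α * Real.log (r k)) * tcD α p q := by
    intro k hk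
    have e1 : ∫ z in (-M)..M, tcG p q (z - Real.log (r k)) * Real.exp (α * z) =
        Real.exp (α * Real.log (r k)) * ∫ y in (-M - Real.log (r k))..(M - Real.log (r k)),
          tcG p q y * Real.exp (α * y) := by
      rw [← intervalIntegral.integral_comp_sub_right
        (fun y => tcG p q y * Real.exp (α * y)), ← intervalIntegral.integral_const_mul]
      congr 1
      ext z
      have : Real.exp (α * z) = Real.exp (α * Real.log (r k)) *
          Real.exp (α * (z - Real.log (r k))) := by
        rw [← Real.exp_add]; congr 1; ring
      rw [this]; ring
    rw [e1]
    refine mul_le_mul_of_nonneg_left ?_ (Real.exp_pos _).le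
    have hb := abs_le.1 (hBr k)
    have hx0 := abs_nonneg x
    obtain ⟨c0, hc0, hc⟩ := tc_int_G p q hp hq α (-M - Real.log (r k)) (M - Real.log (r k)) hα
      (fun i _ => by have := abs_le.1 (hBp i); linarith [this.1])
      (fun i _ => by have := abs_le.1 (hBp i); linarith [this.2])
      (fun i _ => by have := abs_le.1 (hBq i); linarith [this.1])
      (fun i _ => by have := abs_le.1 (hBq i); linarith [this.2])
    rw [hc]
    rcases hα with h1 | ⟨h1, h2⟩
    · have : 0 ≤ c0 * (tcZ p - tcZ q) := by
        rw [hc0 h1]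
        exact mul_nonneg (by positivity) (by linarith)
      linarith
    · rw [tcZ_zero p h1, tcZ_zero q h2]; simp
  have hfin := hIntg.trans_le (Finset.sum_le_sum hterm)
  rw [← Finset.sum_mul] at hfin
  have : 0 < ∑ k ∈ S, Real.exp (α * Real.log (r k)) :=
    Finset.sum_pos (fun k _ => Real.exp_pos _) hSne
  exact (pos_iff_pos_of_mul_pos hfin).1 this

theorem tc_shrink (g : ℝ → ℝ) (hg : Continuous g) (α a0 w1 w2 w3 w4 b0 : ℝ)
    (ha : a0 < w1) (hb : w4 < b0)
    (hga : ∀ y, a0 < y → y ≤ w2 → 0 < g y) (hgb : ∀ y, w3 ≤ y → y < b0 → 0 < g y)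
    (hIntg : 0 < ∫ y in a0..b0, g y * Real.exp (α * y)) :
    ∃ a b, a ≤ w1 ∧ w4 ≤ b ∧ (∀ y ∈ Set.Icc a w2, 0 < g y) ∧
      (∀ y ∈ Set.Icc w3 b, 0 < g y) ∧ 0 < ∫ y in a..b, g y * Real.exp (α * y) := by
  have hcont : Continuous fun y => g y * Real.exp (α * y) := by fun_prop
  have hP : Continuous fun z => ∫ y in (0 : ℝ)..z, g y * Real.exp (α * y) :=
    intervalIntegral.continuous_primitive (fun a b => hcont.intervalIntegrable a b) 0
  have hF : Continuous fun δ => ∫ y in (a0 + δ)..(b0 - δ), g y * Real.exp (α * y) := by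
    have : (fun δ => ∫ y in (a0 + δ)..(b0 - δ), g y * Real.exp (α * y)) = fun δ =>
        (∫ y in (0 : ℝ)..(b0 - δ), g y * Real.exp (α * y)) -
          ∫ y in (0 : ℝ)..(a0 + δ), g y * Real.exp (α * y) := by
      ext δ
      rw [intervalIntegral.integral_interval_sub_left (hcont.intervalIntegrable _ _)
        (hcont.intervalIntegrable _ _)]
    rw [this]
    exact (hP.comp (by fun_prop : Continuous fun δ => b0 - δ)).sub
      (hP.comp (by fun_prop : Continuous fun δ => a0 + δ))
  have h1 : ∀ᶠ δ in nhds (0 : ℝ), 0 < ∫ y in (a0 + δ)..(b0 - δ), g y * Real.exp (α * y) := by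
    apply hF.continuousAt.eventually (lt_mem_nhds _)
    simpa using hIntg
  have h2 : ∀ᶠ δ in nhds (0 : ℝ), δ < w1 - a0 := gt_mem_nhds (by linarith)
  have h3 : ∀ᶠ δ in nhds (0 : ℝ), δ < b0 - w4 := gt_mem_nhds (by linarith)
  have h4 := ((h1.and (h2.and h3)).filter_mono nhdsWithin_le_nhds : ∀ᶠ δ in nhdsWithin (0 : ℝ)
    (Set.Ioi 0), _).and self_mem_nhdsWithin
  obtain ⟨δ, ⟨h5, h6, h7⟩, h8⟩ := h4.exists
  have h8' : 0 < δ := h8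
  exact ⟨a0 + δ, b0 - δ, by linarith, by linarith, fun y hy => hga y (by linarith [hy.1]) hy.2,
    fun y hy => hgb y hy.1 (by linarith [hy.2]), h5⟩

theorem tc_dom (V : Finset ℝ) (n u : ℝ → ℝ) (v0 : ℝ) (hv0 : v0 ∈ V) (hu0 : u v0 = 1)
    (hu : ∀ v ∈ V, v ≠ v0 → 0 ≤ u v ∧ u v < 1)
    (h : ∀ β : ℝ, 1 < β → 0 < ∑ v ∈ V, n v * u v ^ β) : 0 ≤ n v0 := by
  classical
  have ht : Filter.Tendsto (fun β : ℝ => ∑ v ∈ V, n v * u v ^ β) Filter.atTop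
      (nhds (∑ v ∈ V, n v * if v = v0 then 1 else 0)) := by
    refine tendsto_finsetSum _ fun v hv => Filter.Tendsto.const_mul _ ?_
    split_ifs with hvv
    · have : (fun β : ℝ => u v ^ β) = fun _ => 1 := by
        ext β
        rw [hvv, hu0, Real.one_rpow]
      change Filter.Tendsto (fun β : ℝ => u v ^ β) Filter.atTop (nhds 1)
      rw [this]
      exact tendsto_const_nhds
    · exact tendsto_rpow_atTop_of_base_lt_one _ (by linarith [(hu v hv hvv).1]) (hu v hv hvv).2
  have e : ∑ v ∈ V, n v * (if v = v0 then (1 : ℝ) else 0) = n v0 := by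
    simp [hv0]
  rw [e] at ht
  refine ge_of_tendsto ht ?_
  filter_upwards [Filter.eventually_gt_atTop (1 : ℝ)] with β hβ
  exact (h β hβ).le

theorem tc_top_pos {m : ℕ} (p q : Fin m → ℝ) (vp : ℝ) (hvp : vp ∈ tcV p q) (hvp0 : 0 < vp)
    (hV : ∀ v ∈ tcV p q, 0 ≤ v ∧ v ≤ vp) (hn : tcN p q vp ≠ 0)
    (hD : ∀ α : ℝ, 0 < α → 0 < tcD α p q) : 0 < tcN p q vp := by
  refine lt_of_le_of_ne (tc_dom (tcV p q) (tcN p q) (fun v => v / vp) vp hvp (div_self hvp0.ne')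
    (fun v hv hne => ⟨div_nonneg (hV v hv).1 hvp0.le,
      (div_lt_one hvp0).2 (lt_of_le_of_ne (hV v hv).2 hne)⟩) fun β hβ => ?_) (Ne.symm hn)
  have h := hD β (by linarith)
  rw [tcD_gen p q β (by linarith) (by linarith), tc_sum_V p q (fun x => x ^ β),
    div_pos_iff_of_pos_right (mul_pos (by linarith) (by linarith))] at h
  have e : ∑ v ∈ tcV p q, tcN p q v * (v / vp) ^ β =
      (∑ v ∈ tcV p q, tcN p q v * v ^ β) / vp ^ β := by
    rw [Finset.sum_div]
    refine Finset.sum_congr rfl fun v hv => ?_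
    rw [Real.div_rpow (hV v hv).1 hvp0.le, mul_div_assoc]
  rw [e]
  exact div_pos h (Real.rpow_pos_of_pos hvp0 _)

theorem tc_bot_pos {m : ℕ} (p q : Fin m → ℝ) (vm : ℝ) (hvm : vm ∈ tcV p q) (hvm0 : 0 < vm)
    (hV : ∀ v ∈ tcV p q, vm ≤ v) (hn : tcN p q vm ≠ 0)
    (hD : ∀ α : ℝ, 0 < tcD α p q) : 0 < tcN p q vm := by
  refine lt_of_le_of_ne (tc_dom (tcV p q) (tcN p q) (fun v => vm / v) vm hvm (div_self hvm0.ne')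
    (fun v hv hne => ⟨div_nonneg hvm0.le (hvm0.le.trans (hV v hv)),
      (div_lt_one (hvm0.trans_le (hV v hv))).2 (lt_of_le_of_ne (hV v hv) (Ne.symm hne))⟩)
      fun β hβ => ?_) (Ne.symm hn)
  have h := hD (-β)
  rw [tcD_gen p q (-β) (by linarith) (by linarith), tc_sum_V p q (fun x => x ^ (-β)),
    div_pos_iff_of_pos_right (mul_pos_of_neg_of_neg (by linarith) (by linarith))] at h
  have e : ∑ v ∈ tcV p q, tcN p q v * (vm / v) ^ β =
      (∑ v ∈ tcV p q, tcN p q v * v ^ (-β)) * vm ^ β := by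
    rw [Finset.sum_mul]
    refine Finset.sum_congr rfl fun v hv => ?_
    rw [Real.div_rpow hvm0.le (hvm0.le.trans (hV v hv)),
      Real.rpow_neg (hvm0.le.trans (hV v hv))]
    ring
  rw [e]
  exact mul_pos h (Real.rpow_pos_of_pos hvm0 _)

theorem tc_int_outside (h : ℝ → ℝ) (a b : ℝ) (hab : a ≤ b) (h0 : ∀ y, a ≤ y → y ≤ b → h y = 0) :
    ∫ y in a..b, h y = 0 := by
  rw [intervalIntegral.integral_congr (g := fun _ => (0 : ℝ))]
  · simp
  · intro y hy
    rw [Set.uIcc_of_le hab] at hy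
    exact h0 y hy.1 hy.2

theorem tc_backward {m : ℕ} (p q : Fin m → ℝ) (hp : IsProbDist p) (hq : IsProbDist q)
    (hne : ¬ ∃ σ : Equiv.Perm (Fin m), p = q ∘ σ) (hqf : ∀ i, q i ≠ 0)
    (hD : ∀ α : ℝ, (0 < α ∨ ((∀ i, p i ≠ 0) ∧ ∀ i, q i ≠ 0)) → 0 < tcD α p q) :
    ∃ (N : ℕ) (ε : ℝ), ∀ x,
      0 ≤ ∑ k ∈ Finset.range (N + 1), (N.choose k : ℝ) * tcG p q (x - k * ε) := by
  classical
  obtain ⟨vm, vp, tm, tp, hvm, hvp, hV, hvm0, hlt, htm, htp0, htp, hnm, hnp, -, -, hGp, hGm⟩ :=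
    tc_windows p q hp hq hne
  have hvp0 : 0 < vp := hvm0.trans_lt hlt
  have htm0 : 0 < tm := hvm0.trans_lt htm
  have hNp : 0 < tcN p q vp := tc_top_pos p q vp hvp hvp0
    (fun v hv => ⟨hvm0.trans (hV v hv).1, (hV v hv).2⟩) hnp fun α hα => hD α (Or.inl hα)
  have hg := tcG_cont p q
  have hhi : ∀ y, Real.log vp ≤ y → tcG p q y = 0 := by
    intro y hy
    have hy' : vp ≤ Real.exp y := (Real.log_le_iff_le_exp hvp0).1 hy
    rw [hGp y (htp.le.trans hy'), max_eq_right, mul_zero]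
    rw [Real.exp_neg, ← div_eq_mul_inv, sub_nonpos, div_le_one (Real.exp_pos _)]
    exact hy'
  have hpos3 : ∀ y, Real.log tp ≤ y → y < Real.log vp → 0 < tcG p q y := by
    intro y h1 h2
    have h1' : tp ≤ Real.exp y := (Real.log_le_iff_le_exp htp0).1 h1
    have h2' : Real.exp y < vp := (Real.lt_log_iff_exp_lt hvp0).1 h2
    rw [hGp y h1']
    refine mul_pos hNp (lt_max_of_lt_left ?_)
    rw [Real.exp_neg, ← div_eq_mul_inv, sub_pos, one_lt_div (Real.exp_pos _)]
    exact h2'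
  have hnn3 : ∀ y, Real.log tp ≤ y → 0 ≤ tcG p q y := by
    intro y h1
    rcases lt_or_ge y (Real.log vp) with h2 | h2
    · exact (hpos3 y h1 h2).le
    · rw [hhi y h2]
  have hltp : Real.log tp < Real.log vp := Real.log_lt_log htp0 htp
  obtain ⟨Bp, hBp0, hBp⟩ := tc_log_bounds p
  obtain ⟨Bq, hBq0, hBq⟩ := tc_log_bounds q
  have hcont : ∀ α : ℝ, Continuous fun y => tcG p q y * Real.exp (α * y) :=
    fun α => by fun_prop
  rcases hvm0.eq_or_lt with hz | hz
  · -- `p` has a zero entry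
    have hN0 : 0 < tcN p q vm := by
      refine lt_of_le_of_ne ?_ (Ne.symm hnm)
      have : (Finset.univ.filter fun i => q i = vm) = ∅ := by
        ext i
        simpa [← hz] using hqf i
      unfold tcN
      rw [this]
      simp
    have hlo : ∀ y, y ≤ Real.log tm → tcG p q y = tcN p q vm := by
      intro y hy
      rw [hGm y ((Real.le_log_iff_exp_le htm0).1 hy), ← hz]
      simp
    set w3 := Real.log tp with hw3
    set b0 := Real.log vp with hb0
    set w2 := min (Real.log tm) w3 with hw2
    have hw2m : w2 ≤ Real.log tm := min_le_left _ _
    have hw23 : w2 ≤ w3 := min_le_right _ _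
    refine tc_catalyst2 (tcG p q) hg (w2 - 1) w2 w3 ((w3 + b0) / 2) (by linarith) hw23
      (by linarith) (fun y hy => by rw [hlo y (hy.trans hw2m)]; exact hN0.le) hnn3 fun α => ?_
    suffices hs : ∃ a, a < w2 - 1 ∧ 0 < ∫ y in a..b0, tcG p q y * Real.exp (α * y) by
      obtain ⟨a, ha, hI⟩ := hs
      exact tc_shrink (tcG p q) hg α a (w2 - 1) w2 w3 ((w3 + b0) / 2) b0 ha (by linarith)
        (fun y _ hy => by rw [hlo y (hy.trans hw2m)]; exact hN0) hpos3 hI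
    rcases lt_or_ge 0 α with hα | hα
    · have hDα := hD α (Or.inl hα)
      have hlim : Filter.Tendsto (fun a : ℝ => Real.exp (α * a) / α * (tcZ p - tcZ q))
          Filter.atBot (nhds 0) := by
        have h1 : Filter.Tendsto (fun a : ℝ => Real.exp (α * a)) Filter.atBot (nhds 0) :=
          Real.tendsto_exp_atBot.comp (Filter.tendsto_id.const_mul_atBot hα)
        simpa using (h1.div_const α).mul_const (tcZ p - tcZ q)
      obtain ⟨a, ha1, ha2, ha3⟩ := ((hlim.eventually (gt_mem_nhds hDα)).and
        ((Filter.eventually_lt_atBot (w2 - 1)).and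
          (Filter.eventually_lt_atBot (-(Bp + Bq))))).exists
      refine ⟨a, ha2, ?_⟩
      set M := Bp + Bq + |b0| with hM
      have hbM : b0 ≤ M := by linarith [le_abs_self b0]
      obtain ⟨c0, hc0, hc⟩ := tc_int_G p q hp hq α a M (Or.inl hα)
        (fun i _ => by have := abs_le.1 (hBp i); linarith [this.1])
        (fun i _ => by have := abs_le.1 (hBp i); linarith [this.2, abs_nonneg b0])
        (fun i _ => by have := abs_le.1 (hBq i); linarith [this.1])
        (fun i _ => by have := abs_le.1 (hBq i); linarith [this.2, abs_nonneg b0])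
      have e1 := intervalIntegral.integral_add_adjacent_intervals (μ := MeasureTheory.volume)
        ((hcont α).intervalIntegrable a b0) ((hcont α).intervalIntegrable b0 M)
      rw [tc_int_outside _ b0 M hbM (fun y hy _ => by rw [hhi y hy, zero_mul]), hc, hc0 hα] at e1
      linarith
    · set w1 := w2 - 1 with hw1
      set K := ∫ y in w1..b0, tcG p q y * Real.exp (α * y) with hK
      set c := tcN p q vm * Real.exp (α * w1) with hc
      have hc0 : 0 < c := mul_pos hN0 (Real.exp_pos _)
      refine ⟨w1 - (|K| / c + 1), by have : 0 ≤ |K| / c := by positivity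
                                     linarith, ?_⟩
      set a := w1 - (|K| / c + 1) with ha
      have haw : a ≤ w1 := by
        have : 0 ≤ |K| / c := by positivity
        linarith
      have e1 := intervalIntegral.integral_add_adjacent_intervals (μ := MeasureTheory.volume)
        ((hcont α).intervalIntegrable a w1) ((hcont α).intervalIntegrable w1 b0)
      have i2 : (w1 - a) * c ≤ ∫ y in a..w1, tcG p q y * Real.exp (α * y) := by
        have := intervalIntegral.integral_mono_on (μ := MeasureTheory.volume) haw
          (continuous_const (y := c) |>.intervalIntegrable _ _)
          ((hcont α).intervalIntegrable a w1) (by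
            intro y hy
            rw [hlo y (by linarith [hy.2]), hc]
            refine mul_le_mul_of_nonneg_left (Real.exp_le_exp.2 ?_) hN0.le
            exact mul_le_mul_of_nonpos_left hy.2 hα)
        rwa [intervalIntegral.integral_const, smul_eq_mul] at this
      have e2 : (w1 - a) * c = |K| + c := by
        rw [ha]; field_simp; ring
      rw [← e1, ← hK]
      linarith [neg_abs_le K]
  · -- both have full rank
    have hpf : ∀ i, p i ≠ 0 := by
      intro i hi
      have h0 : (0 : ℝ) ∈ tcV p q := by
        refine Finset.mem_filter.2 ⟨Finset.mem_union_left _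
          (Finset.mem_image.2 ⟨i, Finset.mem_univ _, hi⟩), ?_⟩
        have : (Finset.univ.filter fun i => q i = 0) = ∅ := by
          ext i
          simpa using hqf i
        unfold tcN
        rw [this]
        have h2 : 0 < (Finset.univ.filter fun i => p i = 0).card :=
          Finset.card_pos.2 ⟨i, Finset.mem_filter.2 ⟨Finset.mem_univ _, hi⟩⟩
        simpa using Finset.nonempty_iff_ne_empty.1 (Finset.card_pos.1 h2)
      linarith [(hV 0 h0).1]
    have hD' : ∀ α : ℝ, 0 < tcD α p q := fun α => hD α (Or.inr ⟨hpf, hqf⟩)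
    have hNm : 0 < tcN p q vm := tc_bot_pos p q vm hvm hz (fun v hv => (hV v hv).1) hnm hD'
    have hlo : ∀ y, y ≤ Real.log vm → tcG p q y = 0 := by
      intro y hy
      have hy' : Real.exp y ≤ vm := (Real.le_log_iff_exp_le hz).1 hy
      rw [hGm y (hy'.trans htm.le), max_eq_right, mul_zero]
      rw [Real.exp_neg, ← div_eq_mul_inv, sub_nonpos, one_le_div (Real.exp_pos _)]
      exact hy'
    have hpos2 : ∀ y, Real.log vm < y → y ≤ Real.log tm → 0 < tcG p q y := by
      intro y h1 h2
      have h1' : vm < Real.exp y := (Real.log_lt_iff_lt_exp hz).1 h1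
      rw [hGm y ((Real.le_log_iff_exp_le htm0).1 h2)]
      refine mul_pos hNm (lt_max_of_lt_left ?_)
      rw [Real.exp_neg, ← div_eq_mul_inv, sub_pos, div_lt_one (Real.exp_pos _)]
      exact h1'
    have hltm : Real.log vm < Real.log tm := Real.log_lt_log hz htm
    have hab : Real.log vm < Real.log vp := Real.log_lt_log hz hlt
    set a0 := Real.log vm with ha0
    set b0 := Real.log vp with hb0
    set w3 := max (Real.log tp) ((a0 + b0) / 2) with hw3
    set w2 := min (Real.log tm) ((a0 + b0) / 2) with hw2
    have h3a : Real.log tp ≤ w3 := le_max_left _ _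
    have h3b : (a0 + b0) / 2 ≤ w3 := le_max_right _ _
    have h3c : w3 < b0 := max_lt hltp (by linarith)
    have h2a : w2 ≤ Real.log tm := min_le_left _ _
    have h2b : w2 ≤ (a0 + b0) / 2 := min_le_right _ _
    have h2c : a0 < w2 := lt_min hltm (by linarith)
    refine tc_catalyst2 (tcG p q) hg ((a0 + w2) / 2) w2 w3 ((w3 + b0) / 2) (by linarith)
      (by linarith) (by linarith) (fun y hy => ?_) (fun y hy => hnn3 y (h3a.trans hy)) fun α => ?_
    · rcases lt_or_ge a0 y with h | h
      · exact (hpos2 y h (hy.trans h2a)).le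
      · rw [hlo y h]
    · refine tc_shrink (tcG p q) hg α a0 _ w2 w3 _ b0 (by linarith) (by linarith)
        (fun y h1 h2 => hpos2 y h1 (h2.trans h2a)) (fun y h1 h2 => hpos3 y (h3a.trans h1) h2) ?_
      set M := Bp + Bq + |b0| + |a0| with hM
      have hbM : b0 ≤ M := by linarith [le_abs_self b0, abs_nonneg a0]
      have haM : -M ≤ a0 := by linarith [neg_abs_le a0, abs_nonneg b0]
      have hab0 := abs_nonneg a0
      have hbb0 := abs_nonneg b0
      obtain ⟨c0, -, hc⟩ := tc_int_G p q hp hq α (-M) M (Or.inr ⟨hpf, hqf⟩)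
        (fun i _ => by have := abs_le.1 (hBp i); linarith [this.1])
        (fun i _ => by have := abs_le.1 (hBp i); linarith [this.2])
        (fun i _ => by have := abs_le.1 (hBq i); linarith [this.1])
        (fun i _ => by have := abs_le.1 (hBq i); linarith [this.2])
      have e1 := intervalIntegral.integral_add_adjacent_intervals (μ := MeasureTheory.volume)
        ((hcont α).intervalIntegrable a0 b0) ((hcont α).intervalIntegrable b0 M)
      have e2 := intervalIntegral.integral_add_adjacent_intervals (μ := MeasureTheory.volume)
        ((hcont α).intervalIntegrable (-M) a0) ((hcont α).intervalIntegrable a0 M)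
      rw [tc_int_outside _ b0 M hbM (fun y hy _ => by rw [hhi y hy, zero_mul])] at e1
      rw [tc_int_outside _ (-M) a0 haM (fun y _ hy => by rw [hlo y hy, zero_mul]), hc,
        tcZ_zero p hpf, tcZ_zero q hqf] at e2
      have := hD' α
      linarith

/-- **Klimesh–Turgut.** For probability distributions `p, q` that are not
permutations of each other, at least one of full rank, `p ≻_T q` iff
`H_α(p) < H_α(q)` for all `α ≠ 0` and `H_Burg(p) < H_Burg(q)` (extended-real valued). -/
theorem trumping_criterion {m : ℕ} (p q : Fin m → ℝ)
    (hp : IsProbDist p) (hq : IsProbDist q)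
    (hne : ¬ ∃ σ : Equiv.Perm (Fin m), p = q ∘ σ)
    (hfull : (∀ i, p i ≠ 0) ∨ ∀ i, q i ≠ 0) :
    Trumps p q ↔
      (∀ α : ℝ, α ≠ 0 → renyiE α p < renyiE α q) ∧ burgE p < burgE q := by
  have hm : 0 < m := by
    rcases Nat.eq_zero_or_pos m with h | h
    · subst h
      have := hp.2
      simp at this
    · exact h
  constructor
  · intro h
    obtain ⟨hZ, hD⟩ := tc_forward p q hp hq hne h
    have hqf : ∀ i, q i ≠ 0 := by
      rcases hfull with hpf | hqf
      · intro i hi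
        have := tcZ_pos q i hi
        rw [tcZ_zero p hpf] at hZ
        linarith
      · exact hqf
    have hnq : ¬ ∃ i, q i = 0 := fun ⟨i, hi⟩ => hqf i hi
    refine ⟨fun α hα => ?_, ?_⟩
    · unfold renyiE
      rw [if_neg (fun hc : α < 0 ∧ ∃ i, q i = 0 => hnq hc.2)]
      split_ifs with hc
      · exact EReal.bot_lt_coe _
      · rw [EReal.coe_lt_coe_iff, tc_renyi_iff p q hp hq α hα]
        apply hD
        rcases lt_or_gt_of_ne hα with h1 | h1
        · exact Or.inr ⟨fun i hi => hc ⟨h1, i, hi⟩, hqf⟩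
        · exact Or.inl h1
    · unfold burgE
      rw [if_neg hnq]
      split_ifs with hc
      · exact EReal.bot_lt_coe _
      · rw [EReal.coe_lt_coe_iff, tc_burg_iff p q hm]
        exact hD 0 (Or.inr ⟨fun i hi => hc ⟨i, hi⟩, hqf⟩)
  · rintro ⟨hR, hB⟩
    have hqf : ∀ i, q i ≠ 0 := by
      intro i hi
      have h1 := hR (-1) (by norm_num)
      have h2 : renyiE (-1) q = ⊥ := by
        unfold renyiE
        exact if_pos ⟨by norm_num, i, hi⟩
      rw [h2] at h1
      exact not_lt_bot h1
    have hnq : ¬ ∃ i, q i = 0 := fun ⟨i, hi⟩ => hqf i hi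
    obtain ⟨N, ε, hN⟩ := tc_backward p q hp hq hne hqf (by
      intro α hα
      by_cases h0 : α = 0
      · subst h0
        rcases hα with h | h
        · exact absurd h (lt_irrefl _)
        · rw [← tc_burg_iff p q hm, ← EReal.coe_lt_coe_iff]
          have hB' := hB
          unfold burgE at hB'
          rwa [if_neg hnq, if_neg (fun ⟨i, hi⟩ => h.1 i hi)] at hB'
      · rw [← tc_renyi_iff p q hp hq α h0, ← EReal.coe_lt_coe_iff]
        have h1 := hR α h0
        unfold renyiE at h1
        rwa [if_neg (fun hc : α < 0 ∧ ∃ i, q i = 0 => hnq hc.2), if_neg] at h1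
        rintro ⟨h2, i, hi⟩
        rcases hα with h | h
        · linarith
        · exact h.1 i hi)
    exact tc_trumps_of_catalyst p q hp hq N ε hN
end
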